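/- There exists a constant N such that for every binary quartic form F(U,V) = aU⁴ + bU³V + cU²V² + dUV³ + eV⁴ with integer coefficients which is irreducible over ℚ and whose discriminant D(F) satisfies |D(F)| ≥ N, the number of pairs (u,v) ∈ ℤ² with F(u,v) = ±1, counted up to the identification of (u,v) with (−u,−v), is at most 26. -/

import Mathlib

/-- The value of the binary quartic form `aU⁴ + bU³V + cU²V² + dUV³ + eV⁴` at a pair. -/
def quarticFormVal (a b c d e : ℤ) (p : ℤ × ℤ) : ℤ :=
  a * p.1 ^ 4 + b * p.1 ^ 3 * p.2 + c * p.1 ^ 2 * p.2 ^ 2 + d * p.1 * p.2 ^ 3 +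
    e * p.2 ^ 4

/-- Solutions of the Thue equation `F(U,V) = ±1`. -/
abbrev QuarticThueSol (a b c d e : ℤ) : Type :=
  {p : ℤ × ℤ // quarticFormVal a b c d e p = 1 ∨ quarticFormVal a b c d e p = -1}

/-- Identification of a solution `(u,v)` with `(-u,-v)`. -/
def pmRelQuartic (a b c d e : ℤ) (p q : QuarticThueSol a b c d e) : Prop :=
  (p : ℤ × ℤ) = (q : ℤ × ℤ) ∨ (p : ℤ × ℤ) = -(q : ℤ × ℤ)

/-- The discriminant of the binary quartic form `aU⁴ + bU³V + cU²V² + dUV³ + eV⁴`. -/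
def quarticDisc (a b c d e : ℤ) : ℤ :=
  256 * a ^ 3 * e ^ 3 - 192 * a ^ 2 * b * d * e ^ 2 - 128 * a ^ 2 * c ^ 2 * e ^ 2 +
    144 * a ^ 2 * c * d ^ 2 * e - 27 * a ^ 2 * d ^ 4 + 144 * a * b ^ 2 * c * e ^ 2 -
    6 * a * b ^ 2 * d ^ 2 * e - 80 * a * b * c ^ 2 * d * e + 18 * a * b * c * d ^ 3 +
    16 * a * c ^ 4 * e - 4 * a * c ^ 3 * d ^ 2 - 27 * b ^ 4 * e ^ 2 +
    18 * b ^ 3 * c * d * e - 4 * b ^ 3 * d ^ 3 - 4 * b ^ 2 * c ^ 3 * e +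
    b ^ 2 * c ^ 2 * d ^ 2

/-- The monic quartic `X⁴ + bX³ + cX² + dX + e` has the complex roots `α 0, …, α 3`. -/
structure QuarticRoots (b c d e : ℤ) (α : Fin 4 → ℂ) : Prop where
  hb : (b : ℂ) = -(α 0 + α 1 + α 2 + α 3)
  hc : (c : ℂ) = α 0 * α 1 + α 0 * α 2 + α 0 * α 3 + α 1 * α 2 + α 1 * α 3 + α 2 * α 3
  hd : (d : ℂ) = -(α 0 * α 1 * α 2 + α 0 * α 1 * α 3 + α 0 * α 2 * α 3 + α 1 * α 2 * α 3)
  he : (e : ℂ) = α 0 * α 1 * α 2 * α 3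

theorem QuarticRoots.root {b c d e : ℤ} {α : Fin 4 → ℂ} (h : QuarticRoots b c d e α)
    (i : Fin 4) : α i ^ 4 = -(b * α i ^ 3 + c * α i ^ 2 + d * α i + e) := by
  rw [h.hb, h.hc, h.hd, h.he]
  fin_cases i <;> simp <;> ring

/-- Coefficients of the remainder of `X ^ k` modulo `X⁴ + bX³ + cX² + dX + e`. -/
def powRem (b c d e : ℤ) : ℕ → Fin 4 → ℤ
  | 0 => ![1, 0, 0, 0]
  | k + 1 => ![-e * powRem b c d e k 3, powRem b c d e k 0 - d * powRem b c d e k 3,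
      powRem b c d e k 1 - c * powRem b c d e k 3, powRem b c d e k 2 - b * powRem b c d e k 3]

theorem QuarticRoots.sum_powRem {b c d e : ℤ} {α : Fin 4 → ℂ} (h : QuarticRoots b c d e α)
    (i : Fin 4) (k : ℕ) : ∑ s : Fin 4, (powRem b c d e k s : ℂ) * α i ^ (s : ℕ) = α i ^ k := by
  induction k with
  | zero => simp [powRem, Fin.sum_univ_four]
  | succ k ih =>
    rw [pow_succ, ← ih]
    simp only [powRem, Fin.sum_univ_four]
    simp
    linear_combination (-(powRem b c d e k 3 : ℂ)) * h.root i

theorem abs_powRem_le {b c d e : ℤ} {H : ℝ} (hb : |(b : ℝ)| ≤ H) (hc : |(c : ℝ)| ≤ H)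
    (hd : |(d : ℝ)| ≤ H) (he : |(e : ℝ)| ≤ H) (k : ℕ) (s : Fin 4) :
    |(powRem b c d e k s : ℝ)| ≤ (1 + H) ^ k := by
  have hH : 0 ≤ H := (abs_nonneg _).trans hb
  induction k generalizing s with
  | zero => fin_cases s <;> simp [powRem]
  | succ k ih =>
    have key : ∀ (u v w : ℝ), |u| ≤ (1 + H) ^ k → |v| ≤ H → |w| ≤ (1 + H) ^ k →
        |u - v * w| ≤ (1 + H) ^ (k + 1) := by
      intro u v w hu hv hw
      calc |u - v * w| ≤ |u| + |v * w| := abs_sub _ _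
        _ = |u| + |v| * |w| := by rw [abs_mul]
        _ ≤ (1 + H) ^ k + H * (1 + H) ^ k := by gcongr
        _ = _ := by ring
    fin_cases s
    · have := key 0 e (powRem b c d e k 3) (by simpa using by positivity) he (ih 3)
      simpa [powRem] using this
    · have := key _ _ _ (ih 0) hd (ih 3)
      simpa [powRem] using this
    · have := key _ _ _ (ih 1) hc (ih 3)
      simpa [powRem] using this
    · have := key _ _ _ (ih 2) hb (ih 3)
      simpa [powRem] using this

theorem QuarticRoots.abs_coeff_le {b c d e : ℤ} {α : Fin 4 → ℂ} (h : QuarticRoots b c d e α)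
    {A : ℝ} (hA : 2 ≤ A) (hα : ∀ i, ‖α i‖ ≤ A) :
    |(b : ℝ)| ≤ 2 * A ^ 4 ∧ |(c : ℝ)| ≤ 2 * A ^ 4 ∧ |(d : ℝ)| ≤ 2 * A ^ 4 ∧
      |(e : ℝ)| ≤ 2 * A ^ 4 := by
  have h2 : 4 ≤ A ^ 2 := by nlinarith
  have h3 : 2 * A ^ 2 ≤ A ^ 3 := by nlinarith
  have h4 : 2 * A ^ 3 ≤ A ^ 4 := by nlinarith
  have e2 : ∀ i j, ‖α i * α j‖ ≤ A ^ 2 := fun i j => by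
    rw [norm_mul, pow_two]
    exact mul_le_mul (hα i) (hα j) (norm_nonneg _) (by linarith)
  have e3 : ∀ i j k, ‖α i * α j * α k‖ ≤ A ^ 3 := fun i j k => by
    rw [norm_mul, pow_succ]
    exact mul_le_mul (e2 i j) (hα k) (norm_nonneg _) (by positivity)
  have e4 : ‖α 0 * α 1 * α 2 * α 3‖ ≤ A ^ 4 := by
    rw [norm_mul, pow_succ]
    exact mul_le_mul (e3 _ _ _) (hα _) (norm_nonneg _) (by positivity)
  have cast : ∀ n : ℤ, |(n : ℝ)| = ‖(n : ℂ)‖ := fun n => by simp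
  refine ⟨?_, ?_, ?_, ?_⟩
  · rw [cast, h.hb, norm_neg]
    refine (norm_add_le_of_le (norm_add_le_of_le (norm_add_le_of_le (hα 0) (hα 1)) (hα 2))
      (hα 3)).trans ?_
    nlinarith
  · rw [cast, h.hc]
    refine (norm_add_le_of_le (norm_add_le_of_le (norm_add_le_of_le (norm_add_le_of_le
      (norm_add_le_of_le (e2 _ _) (e2 _ _)) (e2 _ _)) (e2 _ _)) (e2 _ _)) (e2 _ _)).trans ?_
    nlinarith
  · rw [cast, h.hd, norm_neg]
    refine (norm_add_le_of_le (norm_add_le_of_le (norm_add_le_of_le (e3 _ _ _) (e3 _ _ _))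
      (e3 _ _ _)) (e3 _ _ _)).trans ?_
    nlinarith
  · rw [cast, h.he]
    exact e4.trans (by nlinarith)

section

open Polynomial

theorem QuarticRoots.exists_polynomial_pair {b c d e : ℤ} {α : Fin 4 → ℂ}
    (h : QuarticRoots b c d e α) {A : ℝ} (hA : 2 ≤ A) (hα : ∀ i, ‖α i‖ ≤ A) {k : ℕ}
    (hk : 1 ≤ k) :
    ∃ p q : ℤ[X], (p ≠ 0 ∨ q ≠ 0) ∧ p.natDegree ≤ 41 * k ∧ q.natDegree ≤ 41 * k ∧
      (∀ i, |(p.coeff i : ℝ)| ≤ A ^ (16400 * k)) ∧ (∀ i, |(q.coeff i : ℝ)| ≤ A ^ (16400 * k)) ∧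
      ∀ i, ∀ j < 20 * k, ((hasseDeriv j p).map (Int.castRingHom ℂ)).eval (α i) =
        α i * ((hasseDeriv j q).map (Int.castRingHom ℂ)).eval (α i) := by
  obtain ⟨hb, hc, hd, he⟩ := h.abs_coeff_le hA hα
  have hrem : ∀ r s, |(powRem b c d e r s : ℝ)| ≤ A ^ (6 * r) := fun r s => by
    refine (abs_powRem_le hb hc hd he r s).trans ?_
    rw [pow_mul]
    gcongr
    have : 16 ≤ A ^ 4 := by
      calc (16 : ℝ) = 2 ^ 4 := by norm_num
        _ ≤ _ := by gcongr
    nlinarith [mul_le_mul hA hA (by norm_num) (by linarith)]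
  set n := 41 * k with hn
  let M : Matrix (Fin (20 * k) × Fin 4) (Fin (n + 1) ⊕ Fin (n + 1)) ℤ := fun js t =>
    Sum.elim (fun r : Fin (n + 1) => ((r : ℕ).choose js.1 : ℤ) * powRem b c d e (r - js.1) js.2)
      (fun r : Fin (n + 1) => -(((r : ℕ).choose js.1 : ℤ) * powRem b c d e (r - js.1 + 1) js.2)) t
  have hA1 : (1 : ℝ) ≤ A := by linarith
  have hchoose : ∀ r ≤ n, ∀ j, ((r.choose j : ℕ) : ℝ) ≤ A ^ n := fun r hr j => by
    calc ((r.choose j : ℕ) : ℝ) ≤ ((2 ^ r : ℕ) : ℝ) := by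
          exact_mod_cast Nat.choose_le_two_pow r j
      _ = 2 ^ r := by push_cast; rfl
      _ ≤ A ^ r := by gcongr
      _ ≤ A ^ n := pow_le_pow_right₀ hA1 hr
  have hentry : ∀ js t, ‖M js t‖ ≤ A ^ (8 * n) := by
    have aux : ∀ r ≤ n, ∀ j, ∀ u ≤ n + 1, ∀ s,
        |((r.choose j : ℕ) : ℝ) * (powRem b c d e u s : ℝ)| ≤ A ^ (8 * n) := by
      intro r hr j u hu s
      rw [abs_mul, Nat.abs_cast]
      calc _ ≤ A ^ n * A ^ (6 * u) := by
            gcongr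
            · exact hchoose r hr j
            · exact hrem u s
        _ = A ^ (n + 6 * u) := by rw [pow_add]
        _ ≤ _ := pow_le_pow_right₀ hA1 (by omega)
    rintro ⟨j, s⟩ (r | r)
    · rw [Int.norm_eq_abs]
      have := aux r (by omega) j (r - j) (by omega) s
      simpa [M] using this
    · rw [Int.norm_eq_abs]
      have := aux r (by omega) j (r - j + 1) (by omega) s
      simpa [M] using this
  let := @Matrix.seminormedAddCommGroup (Fin (20 * k) × Fin 4) (Fin (n + 1) ⊕ Fin (n + 1)) ℤ
  obtain ⟨t, ht0, htM, htn⟩ := Int.Matrix.exists_ne_zero_int_vec_norm_le M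
    (by simp; omega) (by simp; omega)
  have hMn : ‖M‖ ≤ A ^ (8 * n) := by
    rw [Matrix.norm_le_iff (by positivity)]
    exact fun i j => hentry i j
  have htb : ∀ r, |(t r : ℝ)| ≤ A ^ (16400 * k) := by
    intro r
    rw [← Int.norm_eq_abs]
    refine (norm_le_pi_norm t r).trans (htn.trans ?_)
    have hbase : ((Fintype.card (Fin (n + 1) ⊕ Fin (n + 1)) : ℝ) * max 1 ‖M‖) ≤ A ^ (10 * n) := by
      have h1 : (Fintype.card (Fin (n + 1) ⊕ Fin (n + 1)) : ℝ) ≤ A ^ (2 * n) := by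
        simp only [Fintype.card_sum, Fintype.card_fin]
        have : n + 1 + (n + 1) ≤ 2 ^ (2 * n) := by
          have h1 := Nat.lt_two_pow_self (n := 2 * n - 1)
          have h2 : 2 ^ (2 * n) = 2 * 2 ^ (2 * n - 1) := by
            rw [← pow_succ']; congr 1; omega
          omega
        calc ((n + 1 + (n + 1) : ℕ) : ℝ) ≤ ((2 ^ (2 * n) : ℕ) : ℝ) := by exact_mod_cast this
          _ = 2 ^ (2 * n) := by push_cast; rfl
          _ ≤ _ := by gcongr
      calc _ ≤ A ^ (2 * n) * A ^ (8 * n) := by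
            gcongr
            exact max_le (one_le_pow₀ hA1) hMn
        _ = _ := by rw [← pow_add]; congr 1; ring
    have hbase1 : 1 ≤ ((Fintype.card (Fin (n + 1) ⊕ Fin (n + 1)) : ℝ) * max 1 ‖M‖) := by
      apply one_le_mul_of_one_le_of_one_le
      · simp
        have : (0 : ℝ) ≤ n := by positivity
        linarith
      · exact le_max_left _ _
    calc _ ≤ ((Fintype.card (Fin (n + 1) ⊕ Fin (n + 1)) : ℝ) * max 1 ‖M‖) ^ (40 : ℝ) := by
          apply Real.rpow_le_rpow_of_exponent_le hbase1
          have : (1 : ℝ) ≤ k := by exact_mod_cast hk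
          simp only [Fintype.card_sum, Fintype.card_fin, Fintype.card_prod, hn]
          push_cast
          rw [div_le_iff₀ (by linarith)]
          linarith
      _ ≤ (A ^ (10 * n)) ^ (40 : ℝ) := by
          apply Real.rpow_le_rpow _ hbase (by norm_num)
          linarith
      _ = A ^ (16400 * k) := by
          have : (40 : ℝ) = ((40 : ℕ) : ℝ) := by norm_num
          rw [this, Real.rpow_natCast, ← pow_mul]
          congr 1
          omega
  let p : ℤ[X] := ∑ r : Fin (n + 1), monomial (r : ℕ) (t (Sum.inl r))
  let q : ℤ[X] := ∑ r : Fin (n + 1), monomial (r : ℕ) (t (Sum.inr r))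
  have coeff_sum : ∀ (g : Fin (n + 1) → ℤ) (i : ℕ),
      (∑ r : Fin (n + 1), monomial (r : ℕ) (g r)).coeff i =
        if hi : i < n + 1 then g ⟨i, hi⟩ else 0 := by
    intro g i
    rw [finsetSum_coeff]
    split_ifs with hi
    · rw [Finset.sum_eq_single ⟨i, hi⟩]
      · simp
      · intro r _ hr
        rw [coeff_monomial, if_neg]
        exact fun hri => hr (Fin.ext hri)
      · simp
    · refine Finset.sum_eq_zero fun r _ => ?_
      rw [coeff_monomial, if_neg]
      omega
  have deg_sum : ∀ (g : Fin (n + 1) → ℤ),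
      (∑ r : Fin (n + 1), monomial (r : ℕ) (g r)).natDegree ≤ n := fun g => by
    refine natDegree_sum_le_of_forall_le _ _ fun r _ => (natDegree_monomial_le _).trans (by omega)
  have bound_sum : ∀ (g : Fin (n + 1) → ℤ), (∀ r, |(g r : ℝ)| ≤ A ^ (16400 * k)) → ∀ i,
      |((∑ r : Fin (n + 1), monomial (r : ℕ) (g r)).coeff i : ℝ)| ≤ A ^ (16400 * k) := by
    intro g hg i
    rw [coeff_sum]
    split_ifs with hi
    · exact hg _
    · simp; positivity
  refine ⟨p, q, ?_, deg_sum _, deg_sum _, bound_sum _ fun r => htb _, bound_sum _ fun r => htb _, ?_⟩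
  · by_contra! hpq
    apply ht0
    funext r
    rcases r with r | r
    · have := coeff_sum (fun r => t (Sum.inl r)) r
      rw [dif_pos r.2] at this
      change p.coeff r = _ at this
      rw [hpq.1] at this
      simpa using this.symm
    · have := coeff_sum (fun r => t (Sum.inr r)) r
      rw [dif_pos r.2] at this
      change q.coeff r = _ at this
      rw [hpq.2] at this
      simpa using this.symm
  · intro i j hj
    have ev : ∀ (g : Fin (n + 1) → ℤ), ((hasseDeriv j (∑ r : Fin (n + 1),
        monomial (r : ℕ) (g r))).map (Int.castRingHom ℂ)).eval (α i) =
        ∑ r : Fin (n + 1), ((r : ℕ).choose j : ℂ) * g r * α i ^ ((r : ℕ) - j) := by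
      intro g
      simp [hasseDeriv_monomial, Polynomial.map_sum, eval_finsetSum]
    rw [ev, ev, Finset.mul_sum, ← sub_eq_zero, ← Finset.sum_sub_distrib]
    have hrow : ∀ s : Fin 4, ∑ r : Fin (n + 1),
        (((r : ℕ).choose j : ℂ) * powRem b c d e (r - j) s * t (Sum.inl r) -
          ((r : ℕ).choose j : ℂ) * powRem b c d e (r - j + 1) s * t (Sum.inr r)) = 0 := by
      intro s
      have := congrFun htM (⟨j, hj⟩, s)
      simp only [Matrix.mulVec, dotProduct, Fintype.sum_sum_type, M, Sum.elim_inl,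
        Sum.elim_inr, Pi.zero_apply] at this
      have := congrArg (Int.cast : ℤ → ℂ) this
      push_cast at this
      rw [Finset.sum_sub_distrib, sub_eq_add_neg, ← Finset.sum_neg_distrib]
      convert this using 3
      ring
    calc _ = ∑ r : Fin (n + 1), ∑ s : Fin 4, (((r : ℕ).choose j : ℂ) * powRem b c d e (r - j) s *
          t (Sum.inl r) - ((r : ℕ).choose j : ℂ) * powRem b c d e (r - j + 1) s *
            t (Sum.inr r)) * α i ^ (s : ℕ) := by
          refine Finset.sum_congr rfl fun r _ => ?_
          have h1 := h.sum_powRem i (r - j)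
          have h2 := h.sum_powRem i (r - j + 1)
          rw [pow_succ] at h2
          simp only [sub_mul, Finset.sum_sub_distrib]
          rw [← h1] at h2
          have e1 : ∀ (u v : ℂ) (w : ℕ), ∑ s : Fin 4, u * (powRem b c d e w s : ℂ) * v * α i ^ (s : ℕ)
              = u * v * ∑ s : Fin 4, (powRem b c d e w s : ℂ) * α i ^ (s : ℕ) := by
            intro u v w
            rw [Finset.mul_sum]
            exact Finset.sum_congr rfl fun s _ => by ring
          rw [e1, e1, h2, h1]
          ring
      _ = 0 := by
          rw [Finset.sum_comm]
          refine Finset.sum_eq_zero fun s _ => ?_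
          rw [← Finset.sum_mul, hrow, zero_mul]


theorem exists_C_mul_of_wronskian_eq_zero {p q : ℂ[X]} (hpq : p ≠ 0 ∨ q ≠ 0)
    (hW : wronskian p q = 0) :
    ∃ (g : ℂ[X]) (u v : ℂ), g ≠ 0 ∧ (u ≠ 0 ∨ v ≠ 0) ∧ p = C u * g ∧ q = C v * g := by
  by_cases hq : q = 0
  · exact ⟨p, 1, 0, by simpa [hq] using hpq, by simp, by simp, by simp [hq]⟩
  have hcop := isCoprime_div_gcd_div_gcd (p := p) hq
  set g := gcd p q with hg
  have hg0 : g ≠ 0 := fun h0 => hq ((gcd_eq_zero_iff _ _).1 h0).2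
  have hp' : g * (p / g) = p := EuclideanDomain.mul_div_cancel' hg0 (gcd_dvd_left _ _)
  have hq' : g * (q / g) = q := EuclideanDomain.mul_div_cancel' hg0 (gcd_dvd_right _ _)
  set r := p / g
  set s := q / g
  have hW' : wronskian r s = 0 := by
    have : wronskian p q = g ^ 2 * wronskian r s := by
      rw [← hp', ← hq']
      simp only [wronskian, derivative_mul]
      ring
    rw [this] at hW
    simpa [hg0] using hW
  obtain ⟨h1, h2⟩ := hcop.wronskian_eq_zero_iff.1 hW'
  have e1 := eq_C_of_natDegree_eq_zero (derivative_eq_zero.1 h1)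
  have e2 := eq_C_of_natDegree_eq_zero (derivative_eq_zero.1 h2)
  refine ⟨g, r.coeff 0, s.coeff 0, hg0, ?_, ?_, ?_⟩
  · by_contra! h0
    apply hq
    rw [← hq', e2, h0.2]
    simp
  · rw [← e1, mul_comm, hp']
  · rw [← e2, mul_comm, hq']

theorem X_sub_C_pow_dvd_wronskian {p q : ℂ[X]} {m : ℕ} {z w : ℂ}
    (h : (X - C z) ^ (m + 1) ∣ p - C w * q) : (X - C z) ^ m ∣ wronskian p q := by
  have e : wronskian p q = (p - C w * q) * derivative q - derivative (p - C w * q) * q := by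
    simp only [wronskian, derivative_sub, derivative_C_mul]
    ring
  rw [e]
  refine dvd_sub (Dvd.dvd.mul_right ((pow_dvd_pow _ m.le_succ).trans h) _) ?_
  exact Dvd.dvd.mul_right (by simpa using pow_sub_one_dvd_derivative_of_pow_dvd h) _

theorem exists_hasseDeriv_eval_ne {α : Fin 4 → ℂ} (hα : Function.Injective α) {p q : ℂ[X]}
    (hpq : p ≠ 0 ∨ q ≠ 0) {m n : ℕ} (hp : p.natDegree ≤ n) (hq : q.natDegree ≤ n)
    (hm : 1 ≤ m) (hn : 2 * m ≤ n) (hmn : n < 3 * m)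
    (hdvd : ∀ i, (X - C (α i)) ^ m ∣ p - C (α i) * q)
    {z w : ℂ} (hz : ∀ i, z ≠ α i) :
    ∃ j, j + 4 * m ≤ 2 * n + 4 ∧ (hasseDeriv j p).eval z ≠ w * (hasseDeriv j q).eval z := by
  by_contra! hall
  obtain ⟨m, rfl⟩ : ∃ m', m = m' + 1 := ⟨m - 1, by omega⟩
  have hz' : (X - C z) ^ ((2 * n - 4 * m) + 1) ∣ p - C w * q := by
    rw [X_sub_C_pow_dvd_iff, ← taylor_apply, X_pow_dvd_iff]
    intro j hj
    rw [taylor_coeff, map_sub, ← smul_eq_C_mul, map_smul, eval_sub, eval_smul, smul_eq_mul,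
      hall j (by omega), sub_self]
  have cop : ∀ {u v : ℂ} (r s : ℕ), u ≠ v → IsCoprime ((X - C u) ^ r) ((X - C v) ^ s) :=
    fun r s huv => (isCoprime_X_sub_C_of_isUnit_sub (sub_ne_zero.2 huv).isUnit).pow
  by_cases hW : wronskian p q = 0
  · obtain ⟨g, u, v, hg, huv, rfl, rfl⟩ := exists_C_mul_of_wronskian_eq_zero hpq hW
    have hdvd' : ∀ i, u ≠ α i * v → (X - C (α i)) ^ (m + 1) ∣ g := by
      intro i hi
      have h1 := hdvd i
      have e : C u * g - C (α i) * (C v * g) = C (u - α i * v) * g := by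
        simp only [C_sub, C_mul]
        ring
      rw [e] at h1
      exact (dvd_C_mul (sub_ne_zero.2 hi)).1 h1
    have hgdeg : g.natDegree ≤ n := by
      rcases huv with h0 | h0
      · rwa [natDegree_C_mul h0] at hp
      · rwa [natDegree_C_mul h0] at hq
    have three : ∃ S : Finset (Fin 4), 3 ≤ S.card ∧ ∀ i ∈ S, u ≠ α i * v := by
      classical
      by_cases hex : ∃ i, u = α i * v
      · obtain ⟨i, hi⟩ := hex
        refine ⟨Finset.univ.erase i, by simp, fun j hj hj' => ?_⟩
        have hv : v ≠ 0 := by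
          rintro rfl
          simp at hi
          simp [hi] at huv
        exact (Finset.ne_of_mem_erase hj) (hα (mul_right_cancel₀ hv (hj'.symm.trans hi)))
      · exact ⟨Finset.univ, by simp, fun i _ hi => hex ⟨i, hi⟩⟩
    obtain ⟨S, hS, hS'⟩ := three
    have hprod : ∏ i ∈ S, (X - C (α i)) ^ (m + 1) ∣ g :=
      Finset.prod_dvd_of_coprime (fun i _ j _ hij => cop _ _ (hα.ne hij))
        fun i hi => hdvd' i (hS' i hi)
    have := natDegree_le_of_dvd hprod hg
    rw [natDegree_prod_of_monic _ _ fun i _ => (monic_X_sub_C _).pow _] at this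
    simp only [natDegree_pow, natDegree_X_sub_C, Finset.sum_const, smul_eq_mul] at this
    nlinarith
  · have hprod : ∏ i, (X - C (α i)) ^ m ∣ wronskian p q :=
      Finset.prod_dvd_of_coprime (fun i _ j _ hij => cop _ _ (hα.ne hij))
        fun i _ => X_sub_C_pow_dvd_wronskian (hdvd i)
    have hall' : (∏ i, (X - C (α i)) ^ m) * (X - C z) ^ (2 * n - 4 * m) ∣ wronskian p q :=
      (IsCoprime.prod_left fun i _ => cop _ _ (hz i).symm).mul_dvd hprod
        (X_sub_C_pow_dvd_wronskian hz')
    have h1 := natDegree_le_of_dvd hall' hW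
    have h2 := natDegree_wronskian_lt_add hW
    rw [Monic.natDegree_mul (monic_prod_of_monic _ _ fun i _ => (monic_X_sub_C _).pow _)
      ((monic_X_sub_C _).pow _),
      natDegree_prod_of_monic _ _ fun i _ => (monic_X_sub_C _).pow _] at h1
    simp only [natDegree_pow, natDegree_X_sub_C, Finset.sum_const, smul_eq_mul,
      Finset.card_univ, Fintype.card_fin] at h1
    omega

theorem map_hasseDeriv_intCast {K : Type*} [Ring K] (j : ℕ) (p : ℤ[X]) :
    (hasseDeriv j p).map (Int.castRingHom K) = hasseDeriv j (p.map (Int.castRingHom K)) := by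
  ext i
  simp [hasseDeriv_coeff]

theorem norm_eval_hasseDeriv_le {f : ℂ[X]} {n : ℕ} (hn : f.natDegree ≤ n) {B R : ℝ}
    (hf : ∀ i, ‖f.coeff i‖ ≤ B) {z : ℂ} (hR : 1 ≤ R) (hz : ‖z‖ ≤ R) (j : ℕ) :
    ‖(hasseDeriv j f).eval z‖ ≤ 4 ^ n * B * R ^ n := by
  have hB : 0 ≤ B := (norm_nonneg _).trans (hf 0)
  have h4 : ((n : ℝ) + 1) * 2 ^ n ≤ 4 ^ n := by
    have : n + 1 ≤ 2 ^ n := Nat.lt_two_pow_self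
    calc ((n : ℝ) + 1) * 2 ^ n ≤ 2 ^ n * 2 ^ n := by
          gcongr
          exact_mod_cast this
      _ = 4 ^ n := by rw [← mul_pow]; norm_num
  rw [hasseDeriv_apply, sum_over_range' _ _ (n + 1) (by omega), eval_finsetSum]
  · calc _ ≤ ∑ i ∈ Finset.range (n + 1), (2 ^ n * B * R ^ n : ℝ) := by
          refine norm_sum_le_of_le _ fun i hi => ?_
          have hi : i ≤ n := by simpa [Nat.lt_succ_iff] using hi
          rw [eval_monomial, norm_mul, norm_mul, norm_pow, Complex.norm_natCast]
          have h1 : ((i.choose j : ℕ) : ℝ) ≤ 2 ^ n := by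
            have : i.choose j ≤ 2 ^ n := (Nat.choose_le_two_pow i j).trans
              (Nat.pow_le_pow_right (by norm_num) hi)
            exact_mod_cast this
          have h2 : ‖z‖ ^ (i - j) ≤ R ^ n :=
            (pow_le_pow_left₀ (norm_nonneg _) hz _).trans
              (pow_le_pow_right₀ hR (by omega))
          gcongr
          exact hf i
      _ = ((n : ℝ) + 1) * 2 ^ n * (B * R ^ n) := by
          rw [Finset.sum_const, Finset.card_range, nsmul_eq_mul]
          push_cast
          ring
      _ ≤ _ := by
          rw [mul_assoc (4 ^ n : ℝ)]
          gcongr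
  · simp

theorem norm_eval_hasseDeriv_le_of_dvd {f : ℂ[X]} {n m j : ℕ} (hn : f.natDegree ≤ n) {B : ℝ}
    (hf : ∀ i, ‖f.coeff i‖ ≤ B) (hm : ∀ i < m, f.coeff i = 0) {z : ℂ} (hz : ‖z‖ ≤ 1) :
    ‖(hasseDeriv j f).eval z‖ ≤ 4 ^ n * B * ‖z‖ ^ (m - j) := by
  have hB : 0 ≤ B := (norm_nonneg _).trans (hf 0)
  have h4 : ((n : ℝ) + 1) * 2 ^ n ≤ 4 ^ n := by
    have : n + 1 ≤ 2 ^ n := Nat.lt_two_pow_self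
    calc ((n : ℝ) + 1) * 2 ^ n ≤ 2 ^ n * 2 ^ n := by
          gcongr
          exact_mod_cast this
      _ = 4 ^ n := by rw [← mul_pow]; norm_num
  rw [hasseDeriv_apply, sum_over_range' _ _ (n + 1) (by omega), eval_finsetSum]
  · calc _ ≤ ∑ i ∈ Finset.range (n + 1), (2 ^ n * B * ‖z‖ ^ (m - j) : ℝ) := by
          refine norm_sum_le_of_le _ fun i hi => ?_
          have hi : i ≤ n := by simpa [Nat.lt_succ_iff] using hi
          rw [eval_monomial, norm_mul, norm_mul, norm_pow, Complex.norm_natCast]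
          rcases lt_or_ge i m with him | him
          · rw [hm i him]
            simp only [norm_zero, mul_zero, zero_mul]
            positivity
          have h1 : ((i.choose j : ℕ) : ℝ) ≤ 2 ^ n := by
            have : i.choose j ≤ 2 ^ n := (Nat.choose_le_two_pow i j).trans
              (Nat.pow_le_pow_right (by norm_num) hi)
            exact_mod_cast this
          have h2 : ‖z‖ ^ (i - j) ≤ ‖z‖ ^ (m - j) :=
            pow_le_pow_of_le_one (norm_nonneg _) hz (by omega)
          gcongr
          exact hf i
      _ = ((n : ℝ) + 1) * 2 ^ n * (B * ‖z‖ ^ (m - j)) := by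
          rw [Finset.sum_const, Finset.card_range, nsmul_eq_mul]
          push_cast
          ring
      _ ≤ _ := by
          rw [mul_assoc (4 ^ n : ℝ)]
          gcongr
  · simp

theorem one_le_mul_norm_eval_sub {p q : ℤ[X]} {n : ℕ} (hp : p.natDegree ≤ n)
    (hq : q.natDegree ≤ n) {x y x' y' : ℤ} (hy : 0 < y) (hy' : 0 < y') (j : ℕ)
    (hne : (hasseDeriv j (p.map (Int.castRingHom ℂ))).eval (x / y : ℂ) ≠
      (x' / y' : ℂ) * (hasseDeriv j (q.map (Int.castRingHom ℂ))).eval (x / y : ℂ)) :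
    1 ≤ (y : ℝ) ^ n * y' * ‖(hasseDeriv j (p.map (Int.castRingHom ℂ))).eval (x / y : ℂ) -
      (x' / y' : ℂ) * (hasseDeriv j (q.map (Int.castRingHom ℂ))).eval (x / y : ℂ)‖ := by
  set f : ℤ[X] := C y' * hasseDeriv j p - C x' * hasseDeriv j q with hf
  have hdeg : f.natDegree ≤ n := by
    refine (natDegree_sub_le _ _).trans (max_le ?_ ?_)
    · exact (natDegree_C_mul_le _ _).trans ((natDegree_hasseDeriv_le _ _).trans (by omega))
    · exact (natDegree_C_mul_le _ _).trans ((natDegree_hasseDeriv_le _ _).trans (by omega))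
  have hy0 : (y' : ℂ) ≠ 0 := by exact_mod_cast hy'.ne'
  have hfC : ((eval ((x : ℝ) / y) (f.map (algebraMap ℤ ℝ)) : ℝ) : ℂ) =
      y' * ((hasseDeriv j (p.map (Int.castRingHom ℂ))).eval (x / y : ℂ) -
      (x' / y' : ℂ) * (hasseDeriv j (q.map (Int.castRingHom ℂ))).eval (x / y : ℂ)) := by
    have e1 : ((eval ((x : ℝ) / y) (f.map (algebraMap ℤ ℝ)) : ℝ) : ℂ) =
        eval (x / y : ℂ) (f.map (Int.castRingHom ℂ)) := by
      have := eval_map_algebraMap (B := ℝ) f ((x : ℝ) / y)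
      rw [this, ← Complex.coe_algebraMap, ← aeval_algebraMap_apply, aeval_def, eval_map]
      simp
    rw [e1, hf, Polynomial.map_sub, Polynomial.map_mul, Polynomial.map_mul,
      map_hasseDeriv_intCast, map_hasseDeriv_intCast]
    simp
    field_simp
  have hne' : eval ((x : ℝ) / y) (f.map (algebraMap ℤ ℝ)) ≠ 0 := by
    intro h0
    rw [h0] at hfC
    simp [hy0, sub_eq_zero, hne] at hfC
  have key := one_le_pow_mul_abs_eval_div hy hne'
  have hn : |eval ((x : ℝ) / y) (f.map (algebraMap ℤ ℝ))| =
      y' * ‖(hasseDeriv j (p.map (Int.castRingHom ℂ))).eval (x / y : ℂ) -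
      (x' / y' : ℂ) * (hasseDeriv j (q.map (Int.castRingHom ℂ))).eval (x / y : ℂ)‖ := by
    rw [← Real.norm_eq_abs, ← Complex.norm_real, hfC, norm_mul, Complex.norm_intCast,
      abs_of_pos (by exact_mod_cast hy')]
  rw [hn, ← mul_assoc] at key
  refine key.trans ?_
  have h1 : (1 : ℝ) ≤ y := by exact_mod_cast hy
  have h2 : (0 : ℝ) ≤ y' := by exact_mod_cast hy'.le
  gcongr

theorem norm_eval_hasseDeriv_sub_le {p q : ℤ[X]} {k : ℕ} (hk : 1 ≤ k)
    (hp : p.natDegree ≤ 41 * k) (hq : q.natDegree ≤ 41 * k) {A : ℝ} (hA : 2 ≤ A)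
    (hpc : ∀ i, |(p.coeff i : ℝ)| ≤ A ^ (16400 * k))
    (hqc : ∀ i, |(q.coeff i : ℝ)| ≤ A ^ (16400 * k)) {α : ℂ} (hα : ‖α‖ ≤ A) {m : ℕ}
    (hm : ∀ j < m, ((hasseDeriv j p).map (Int.castRingHom ℂ)).eval α =
        α * ((hasseDeriv j q).map (Int.castRingHom ℂ)).eval α)
    {z w : ℂ} (hz : ‖α - z‖ ≤ 1) (j : ℕ) :
    ‖(hasseDeriv j (p.map (Int.castRingHom ℂ))).eval z -
      w * (hasseDeriv j (q.map (Int.castRingHom ℂ))).eval z‖ ≤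
      A ^ (20000 * k) * (‖α - z‖ ^ (m - j) + ‖α - w‖) := by
  have hA1 : 1 ≤ A := by linarith
  set P := p.map (Int.castRingHom ℂ) with hP
  set Q := q.map (Int.castRingHom ℂ) with hQ
  have hPd : P.natDegree ≤ 41 * k := natDegree_map_le.trans hp
  have hQd : Q.natDegree ≤ 41 * k := natDegree_map_le.trans hq
  have hPc : ∀ i, ‖P.coeff i‖ ≤ A ^ (16400 * k) := fun i => by
    rw [hP, coeff_map]
    simpa using hpc i
  have hQc : ∀ i, ‖Q.coeff i‖ ≤ A ^ (16400 * k) := fun i => by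
    rw [hQ, coeff_map]
    simpa using hqc i
  have h4 : (4 : ℝ) ^ (41 * k) ≤ A ^ (82 * k) := by
    rw [show 82 * k = 2 * (41 * k) by ring, pow_mul A]
    gcongr
    nlinarith
  have hzA : ‖z‖ ≤ A ^ 2 := by
    have : ‖z‖ ≤ ‖α‖ + ‖α - z‖ := by
      have := norm_sub_le α (α - z)
      simpa using this
    nlinarith
  set f := P - C α * Q with hf
  have hfd : f.natDegree ≤ 41 * k :=
    (natDegree_sub_le _ _).trans (max_le hPd ((natDegree_C_mul_le _ _).trans hQd))
  have hfc : ∀ i, ‖f.coeff i‖ ≤ A ^ (16400 * k + 2) := fun i => by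
    rw [hf, coeff_sub, coeff_C_mul]
    calc _ ≤ ‖P.coeff i‖ + ‖α * Q.coeff i‖ := norm_sub_le _ _
      _ = ‖P.coeff i‖ + ‖α‖ * ‖Q.coeff i‖ := by rw [norm_mul]
      _ ≤ A ^ (16400 * k) + A * A ^ (16400 * k) := by
          gcongr
          · exact hPc i
          · exact hQc i
      _ = A ^ (16400 * k) * (1 + A) := by ring
      _ ≤ A ^ (16400 * k) * A ^ 2 := by
          gcongr
          nlinarith
      _ = _ := by ring
  set T := taylor α f with hT
  have hTd : T.natDegree ≤ 41 * k := by rwa [hT, natDegree_taylor]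
  have hTc : ∀ i, ‖T.coeff i‖ ≤ A ^ (16400 * k + 2 + 123 * k) := fun i => by
    rw [hT, taylor_coeff]
    calc _ ≤ 4 ^ (41 * k) * A ^ (16400 * k + 2) * A ^ (41 * k) :=
          norm_eval_hasseDeriv_le hfd hfc hA1 hα i
      _ ≤ A ^ (82 * k) * A ^ (16400 * k + 2) * A ^ (41 * k) := by gcongr
      _ = _ := by ring
  have hTm : ∀ i < m, T.coeff i = 0 := fun i hi => by
    rw [hT, taylor_coeff, hf, map_sub, ← smul_eq_C_mul, map_smul, eval_sub, eval_smul, smul_eq_mul,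
      hP, hQ, ← map_hasseDeriv_intCast, ← map_hasseDeriv_intCast, hm i hi, sub_self]
  have hsplit : (hasseDeriv j P).eval z - w * (hasseDeriv j Q).eval z =
      (hasseDeriv j T).eval (z - α) + (α - w) * (hasseDeriv j Q).eval z := by
    rw [← taylor_coeff (f := T), hT, taylor_taylor, sub_add_cancel, taylor_coeff, hf, map_sub,
      ← smul_eq_C_mul, map_smul, eval_sub, eval_smul, smul_eq_mul]
    ring
  have b1 := norm_eval_hasseDeriv_le_of_dvd (j := j) hTd hTc hTm
    (by rwa [norm_sub_rev] : ‖z - α‖ ≤ 1)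
  have b2 := norm_eval_hasseDeriv_le hQd hQc (one_le_pow₀ hA1) hzA j
  rw [hsplit]
  calc _ ≤ ‖(hasseDeriv j T).eval (z - α)‖ + ‖α - w‖ * ‖(hasseDeriv j Q).eval z‖ := by
        rw [← norm_mul]
        exact norm_add_le _ _
    _ ≤ A ^ (82 * k) * A ^ (16400 * k + 2 + 123 * k) * ‖z - α‖ ^ (m - j) +
        ‖α - w‖ * (A ^ (82 * k) * A ^ (16400 * k) * (A ^ 2) ^ (41 * k)) := by
        gcongr
        · exact b1.trans (by gcongr)
        · exact b2.trans (by gcongr)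
    _ = A ^ (16605 * k + 2) * ‖z - α‖ ^ (m - j) + ‖α - w‖ * A ^ (16564 * k) := by ring
    _ ≤ A ^ (20000 * k) * ‖z - α‖ ^ (m - j) + ‖α - w‖ * A ^ (20000 * k) := by
        gcongr <;> first | exact hA1 | omega
    _ = _ := by rw [norm_sub_rev z α]; ring

theorem pow_mul_add_le_of_sqrt {s s' h h' : ℝ} {k r : ℕ} (hs : 1 ≤ s) (hs' : 1 ≤ s') (h0 : 0 ≤ h)
    (h0' : 0 ≤ h') (hh : h * s ^ 7 ≤ 1) (hh' : h' * s' ^ 7 ≤ 1) (hk : 8 ≤ k)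
    (hr : 18 * k ≤ r + 4) (hlow : s ^ (17 * k) ≤ s') (hup : s' ≤ s ^ (17 * (k + 1))) :
    s ^ (84 * k) * s' ^ 2 * (h ^ r + h') ≤ 2 := by
  have e1 : s ^ (84 * k) * s' ^ 2 * h ^ r ≤ 1 := by
    have hle : h ≤ 1 := by
      have : (1 : ℝ) ≤ s ^ 7 := one_le_pow₀ hs
      nlinarith
    calc s ^ (84 * k) * s' ^ 2 * h ^ r
        ≤ s ^ (84 * k) * (s ^ (17 * (k + 1))) ^ 2 * h ^ (18 * k - 4) := by
          gcongr ?_ * ?_ ^ 2 * ?_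
          exact pow_le_pow_of_le_one h0 hle (by omega)
      _ = s ^ (118 * k + 34) * h ^ (18 * k - 4) := by
          rw [← pow_mul, ← pow_add]
          congr 2
          ring
      _ ≤ s ^ (7 * (18 * k - 4)) * h ^ (18 * k - 4) := by
          gcongr ?_ * _
          exact pow_le_pow_right₀ hs (by omega)
      _ = (h * s ^ 7) ^ (18 * k - 4) := by rw [pow_mul, ← mul_pow, mul_comm]
      _ ≤ 1 := pow_le_one₀ (by positivity) hh
  have e2 : s ^ (84 * k) * s' ^ 2 * h' ≤ 1 := by
    calc s ^ (84 * k) * s' ^ 2 * h' ≤ (s ^ (17 * k)) ^ 5 * s' ^ 2 * h' := by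
          rw [← pow_mul]
          gcongr ?_ * _ * _
          exact pow_le_pow_right₀ hs (by omega)
      _ ≤ s' ^ 5 * s' ^ 2 * h' := by gcongr
      _ = h' * s' ^ 7 := by ring
      _ ≤ 1 := hh'
  linarith [mul_add (s ^ (84 * k) * s' ^ 2) (h ^ r) h']

theorem QuarticRoots.le_pow_of_approx {b c d e : ℤ} {α : Fin 4 → ℂ} (h : QuarticRoots b c d e α)
    (hinj : Function.Injective α) {A : ℝ} (hA : 2 ≤ A) (hα : ∀ i, ‖α i‖ ≤ A)
    {x y x' y' : ℤ} (hy : 0 < y) (hy' : 0 < y') (hne : ∀ i, (x / y : ℂ) ≠ α i)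
    (happ : ‖α 0 - x / y‖ ^ 2 * (y : ℝ) ^ 7 ≤ 1)
    (happ' : ‖α 0 - x' / y'‖ ^ 2 * (y' : ℝ) ^ 7 ≤ 1) (hlarge : A ^ 20001 ≤ y) :
    y' ≤ y ^ 200 := by
  by_contra! hlt
  have hA1 : 1 ≤ A := by linarith
  have hy1 : (1 : ℝ) ≤ y := by exact_mod_cast hy
  have hy1' : (1 : ℝ) ≤ y' := by exact_mod_cast hy'
  have hy2 : 1 < y := by
    have : (2 : ℝ) ≤ y := (hA.trans (le_self_pow₀ hA1 (by norm_num))).trans hlarge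
    have : (2 : ℤ) ≤ y := by exact_mod_cast this
    omega
  obtain ⟨Y, rfl⟩ := Int.eq_ofNat_of_zero_le hy.le
  obtain ⟨Y', rfl⟩ := Int.eq_ofNat_of_zero_le hy'.le
  obtain ⟨k, hk1, hk2⟩ : ∃ k, (Y ^ 17) ^ k ≤ Y' ∧ Y' < (Y ^ 17) ^ (k + 1) := by
    have : 1 < Y ^ 17 := Nat.one_lt_pow (by norm_num) (by exact_mod_cast hy2)
    exact ⟨Nat.log (Y ^ 17) Y', Nat.pow_log_le_self _ (by exact_mod_cast hy'.ne'),
      Nat.lt_pow_succ_log_self this _⟩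
  have hk8 : 8 ≤ k := by
    by_contra! hk
    have h1 : (Y ^ 17) ^ (k + 1) ≤ Y ^ 200 := by
      rw [← pow_mul]
      exact Nat.pow_le_pow_right (by omega) (by omega)
    have h2 : Y ^ 200 < Y' := by exact_mod_cast hlt
    omega
  obtain ⟨p, q, hpq, hpd, hqd, hpc, hqc, hpow⟩ := h.exists_polynomial_pair hA hα
    (show 1 ≤ k by omega)
  simp only [Int.cast_natCast] at *
  obtain ⟨j, hj, hjne⟩ := exists_hasseDeriv_eval_ne (p := p.map (Int.castRingHom ℂ))
    (q := q.map (Int.castRingHom ℂ)) (m := 20 * k) (n := 41 * k) hinj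
    (by simpa [Polynomial.map_eq_zero_iff (RingHom.injective_int (Int.castRingHom ℂ))] using hpq)
    (natDegree_map_le.trans hpd) (natDegree_map_le.trans hqd) (by omega) (by omega) (by omega)
    (fun i => by
      rw [X_sub_C_pow_dvd_iff, ← taylor_apply, X_pow_dvd_iff]
      intro j hj
      rw [taylor_coeff, map_sub, ← smul_eq_C_mul, map_smul, eval_sub, eval_smul, smul_eq_mul,
        ← map_hasseDeriv_intCast, ← map_hasseDeriv_intCast, hpow i j hj, sub_self])
    (z := (x / Y : ℂ)) (w := (x' / Y' : ℂ)) hne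
  have hlow := one_le_mul_norm_eval_sub hpd hqd hy hy' (x := x) (x' := x') j
    (by simpa using hjne)
  set s := √(Y : ℝ) with hs
  set s' := √(Y' : ℝ) with hs'
  have hs1 : 1 ≤ s := Real.one_le_sqrt.2 hy1
  have hs1' : 1 ≤ s' := Real.one_le_sqrt.2 hy1'
  have hsY : s ^ 2 = Y := Real.sq_sqrt (by linarith)
  have hsY' : s' ^ 2 = Y' := Real.sq_sqrt (by linarith)
  have hsmall : ∀ {t u : ℝ}, 0 ≤ t → 0 ≤ u → t ^ 2 * (u ^ 2) ^ 7 ≤ 1 → t * u ^ 7 ≤ 1 := by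
    intro t u ht hu htu
    refine (pow_le_pow_iff_left₀ (by positivity) zero_le_one two_ne_zero).1 ?_
    calc (t * u ^ 7) ^ 2 = t ^ 2 * (u ^ 2) ^ 7 := by ring
      _ ≤ 1 ^ 2 := by simpa using htu
  rw [← hsY] at happ
  rw [← hsY'] at happ'
  have hh := hsmall (norm_nonneg _) (by positivity) happ
  have hh' := hsmall (norm_nonneg _) (by positivity) happ'
  have hz1 : ‖α 0 - x / Y‖ ≤ 1 := by
    have h7 : (1 : ℝ) ≤ s ^ 7 := one_le_pow₀ hs1
    nlinarith [norm_nonneg (α 0 - x / Y)]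
  have hup := norm_eval_hasseDeriv_sub_le (by omega) hpd hqd hA hpc hqc (hα 0)
    (hpow 0) (w := (x' / Y' : ℂ)) hz1 j
  have hk1' : s ^ (17 * k) ≤ s' := by
    refine (pow_le_pow_iff_left₀ (by positivity) (by positivity) two_ne_zero).1 ?_
    rw [hsY', ← pow_mul, mul_comm _ 2, pow_mul, hsY, pow_mul]
    exact_mod_cast hk1
  have hk2' : s' ≤ s ^ (17 * (k + 1)) := by
    refine (pow_le_pow_iff_left₀ (by positivity) (by positivity) two_ne_zero).1 ?_
    rw [hsY', ← pow_mul, mul_comm _ 2, pow_mul, hsY, pow_mul]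
    exact_mod_cast hk2.le
  have hfin := pow_mul_add_le_of_sqrt (r := 20 * k - j) hs1 hs1' (norm_nonneg _) (norm_nonneg _)
    hh hh' hk8 (by omega) hk1' hk2'
  rw [show 84 * k = 2 * (42 * k) by ring, pow_mul, hsY, hsY'] at hfin
  simp only [Int.cast_natCast] at hlow
  have h1 : (A ^ 20001) ^ k ≤ (A ^ 20000) ^ k * 2 := by
    calc (A ^ 20001) ^ k ≤ (Y : ℝ) ^ k * 1 := by
          rw [mul_one]
          gcongr
      _ ≤ (Y : ℝ) ^ k * ((Y : ℝ) ^ (41 * k) * Y' * (A ^ (20000 * k) *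
          (‖α 0 - x / Y‖ ^ (20 * k - j) + ‖α 0 - x' / Y'‖))) := by
          gcongr
          exact hlow.trans (by gcongr)
      _ = (A ^ 20000) ^ k * ((Y : ℝ) ^ (42 * k) * Y' *
          (‖α 0 - x / Y‖ ^ (20 * k - j) + ‖α 0 - x' / Y'‖)) := by
          rw [← pow_mul]
          ring
      _ ≤ _ := by gcongr
  have h2 : (4 : ℝ) ≤ A ^ k := by
    calc (4 : ℝ) ≤ 2 ^ 8 := by norm_num
      _ ≤ 2 ^ k := pow_le_pow_right₀ (by norm_num) hk8
      _ ≤ A ^ k := by gcongr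
  have h3 : 0 < (A ^ 20000) ^ k := by positivity
  rw [show (A ^ 20001) ^ k = (A ^ 20000) ^ k * A ^ k by rw [← mul_pow, ← pow_succ]] at h1
  nlinarith

theorem QuarticRoots.translate {b c d e : ℤ} {α : Fin 4 → ℂ} (h : QuarticRoots b c d e α)
    (t : ℤ) : QuarticRoots (b + 4 * t) (c + 3 * b * t + 6 * t ^ 2)
      (d + 2 * c * t + 3 * b * t ^ 2 + 4 * t ^ 3) (e + d * t + c * t ^ 2 + b * t ^ 3 + t ^ 4)
      fun i => α i - t := by
  constructor <;> push_cast <;> rw [h.hb]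
  · ring
  · rw [h.hc]; ring
  · rw [h.hc, h.hd]; ring
  · rw [h.hc, h.hd, h.he]; ring

theorem QuarticRoots.abs_le_pow_of_approx {b c d e : ℤ} {α : Fin 4 → ℂ}
    (h : QuarticRoots b c d e α) (hinj : Function.Injective α) {A : ℝ} (hA : 2 ≤ A)
    (hα : ∀ i, ‖α i - α 0‖ ≤ A - 2) {x y x' y' : ℤ} (hy : y ≠ 0) (hy' : y' ≠ 0)
    (hne : ∀ i, (x / y : ℂ) ≠ α i) (happ : ‖α 0 - x / y‖ ^ 2 * |(y : ℝ)| ^ 7 ≤ 1)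
    (happ' : ‖α 0 - x' / y'‖ ^ 2 * |(y' : ℝ)| ^ 7 ≤ 1) (hlarge : A ^ 20001 ≤ |(y : ℝ)|) :
    |(y' : ℝ)| ≤ |(y : ℝ)| ^ 200 := by
  wlog hpos : 0 < y generalizing x y
  · have := this (x := -x) (y := -y) (by omega) (by simpa using hne) (by simpa using happ)
      (by simpa using hlarge) (by omega)
    simpa using this
  wlog hpos' : 0 < y' generalizing x' y'
  · have := this (x' := -x') (y' := -y') (by omega) (by simpa using happ') (by omega)
    simpa using this
  have hpos1 : (0 : ℝ) < y := by exact_mod_cast hpos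
  have hpos1' : (0 : ℝ) < y' := by exact_mod_cast hpos'
  have hyC : (y : ℂ) ≠ 0 := by exact_mod_cast hy
  have hyC' : (y' : ℂ) ≠ 0 := by exact_mod_cast hy'
  rw [abs_of_pos hpos1] at happ hlarge ⊢
  rw [abs_of_pos hpos1'] at happ' ⊢
  set t := ⌊(x : ℝ) / y⌋ with ht
  have e1 : ((x - t * y : ℤ) / y : ℂ) = x / y - t := by
    push_cast
    field_simp
  have e1' : ((x' - t * y' : ℤ) / y' : ℂ) = x' / y' - t := by
    push_cast
    field_simp
  have hz : ‖α 0 - x / y‖ ≤ 1 := by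
    have h7 : (1 : ℝ) ≤ (y : ℝ) ^ 7 := one_le_pow₀ (by exact_mod_cast hpos)
    nlinarith [norm_nonneg (α 0 - x / y)]
  have hfr : ‖(x / y : ℂ) - t‖ ≤ 1 := by
    have : (x / y : ℂ) - t = ((Int.fract ((x : ℝ) / y) : ℝ) : ℂ) := by
      rw [Int.fract]
      push_cast
      rfl
    rw [this, Complex.norm_real, Real.norm_of_nonneg (Int.fract_nonneg _)]
    exact (Int.fract_lt_one _).le
  have hα' : ∀ i, ‖α i - t‖ ≤ A := fun i => by
    calc ‖α i - t‖ = ‖(α i - α 0) + (α 0 - x / y) + (x / y - t)‖ := by congr 1; ring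
      _ ≤ ‖α i - α 0‖ + ‖α 0 - x / y‖ + ‖(x / y : ℂ) - t‖ := norm_add₃_le
      _ ≤ (A - 2) + 1 + 1 := by gcongr; exact hα i
      _ = A := by ring
  have := (h.translate t).le_pow_of_approx (fun i j hij => hinj (sub_left_injective hij))
    hA hα' (x := x - t * y) (y := y) (x' := x' - t * y') (y' := y')
    hpos hpos' (fun i => by rw [e1]; exact fun h0 => hne i (sub_left_injective h0))
    (by rw [e1]; simpa using happ) (by rw [e1']; simpa using happ') hlarge
  exact_mod_cast this

/-- The tuples `u` of nonzero complex numbers such that `diag(u)` is conjugate by `V` to an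
invertible integer matrix. -/
def integralTuples (V : (Matrix (Fin 4) (Fin 4) ℂ)ˣ) : Subgroup (Fin 4 → ℂ)ˣ where
  carrier := {u | ∃ W : (Matrix (Fin 4) (Fin 4) ℤ)ˣ,
    Matrix.diagonal (u : Fin 4 → ℂ) * V.val = V.val * W.val.map (Int.castRingHom ℂ)}
  one_mem' := ⟨1, by simp⟩
  mul_mem' := by
    rintro u v ⟨W, hW⟩ ⟨Z, hZ⟩
    refine ⟨W * Z, ?_⟩
    rw [Units.val_mul, Units.val_mul, Matrix.map_mul, ← mul_assoc, ← hW, mul_assoc, ← hZ,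
      ← mul_assoc, Matrix.diagonal_mul_diagonal]
    rfl
  inv_mem' := by
    rintro u ⟨W, hW⟩
    refine ⟨W⁻¹, ?_⟩
    have h1 : Matrix.diagonal (u⁻¹).val * Matrix.diagonal u.val = 1 := by
      rw [Matrix.diagonal_mul_diagonal, ← Matrix.diagonal_one]
      congr 1
      exact u.inv_mul
    have h2 : W.val.map (Int.castRingHom ℂ) * (W⁻¹).val.map (Int.castRingHom ℂ) = 1 := by
      rw [← Matrix.map_mul, Units.mul_inv, Matrix.map_one] <;> simp
    calc Matrix.diagonal (u⁻¹).val * V.val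
        = Matrix.diagonal (u⁻¹).val * (V.val * W.val.map (Int.castRingHom ℂ)) *
          (W⁻¹).val.map (Int.castRingHom ℂ) := by
          rw [mul_assoc, mul_assoc, h2, mul_one]
      _ = _ := by rw [← hW, ← mul_assoc, h1, one_mul]

theorem exists_finite_integralTuples : ∃ S : Finset ℂ, ∀ V, ∀ u ∈ integralTuples V,
    (∀ i, ‖u.val i‖ ≤ 2) → ∀ i, u.val i ∈ S := by
  classical
  have hfin := bUnion_roots_finite (Int.castRingHom ℂ) 4 (Set.finite_Icc (-96 : ℤ) 96)
  refine ⟨hfin.toFinset, ?_⟩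
  rintro V u ⟨W, hW⟩ hu i
  have hchar : (W.val.map (Int.castRingHom ℂ)).charpoly = ∏ j, (X - C (u.val j)) := by
    rw [← Matrix.charpoly_diagonal]
    have : W.val.map (Int.castRingHom ℂ) = (V⁻¹).val * (Matrix.diagonal u.val * V.val) := by
      rw [hW, ← mul_assoc, Units.inv_mul, one_mul]
    rw [this, Matrix.charpoly_mul_comm, mul_assoc, Units.mul_inv, mul_one]
  have hroots : (∏ j, (X - C (u.val j))).roots = Finset.univ.val.map u.val :=
    roots_multiset_prod_X_sub_C (Finset.univ.val.map u.val) |>.symm ▸ by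
      simp
  have hdeg : W.val.charpoly.natDegree = 4 := by simp
  rw [Matrix.charpoly_map] at hchar
  rw [Set.Finite.mem_toFinset, Set.mem_iUnion₂]
  refine ⟨W.val.charpoly, ⟨hdeg.le, fun n => ?_⟩, ?_⟩
  · have := coeff_bdd_of_roots_le (B := 2) (d := 4) (RingHom.id ℂ)
      (p := W.val.charpoly.map (Int.castRingHom ℂ)) ((Matrix.charpoly_monic _).map _)
      (IsAlgClosed.splits _) (natDegree_map_le.trans hdeg.le) (fun z hz => by
        rw [map_id, hchar, hroots] at hz
        obtain ⟨j, -, rfl⟩ := Multiset.mem_map.1 hz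
        exact hu j) n
    rw [map_id, coeff_map] at this
    have h6 : Nat.choose 4 (4 / 2) = 6 := rfl
    rw [h6] at this
    norm_num at this
    rw [Set.mem_Icc, ← abs_le]
    exact_mod_cast this
  · rw [hchar, hroots]
    exact Multiset.mem_toFinset.2 (Multiset.mem_map_of_mem _ (Finset.mem_univ i))

theorem QuarticRoots.exists_integralTuples {b c d e : ℤ} {α : Fin 4 → ℂ}
    (h : QuarticRoots b c d e α) (hinj : Function.Injective α) :
    ∃ V, ∀ x y : ℤ, ‖∏ i, ((x : ℂ) - α i * y)‖ = 1 → ∀ u : (Fin 4 → ℂ)ˣ,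
      (∀ i, u.val i = x - α i * y) → u ∈ integralTuples V := by
  have hV : IsUnit (Matrix.vandermonde α) :=
    (Matrix.isUnit_iff_isUnit_det _).2 (Matrix.det_vandermonde_ne_zero_iff.2 hinj).isUnit
  refine ⟨hV.unit, fun x y hxy u hu => ?_⟩
  set W : Matrix (Fin 4) (Fin 4) ℤ :=
    !![x, 0, 0, y * e; -y, x, 0, y * d; 0, -y, x, y * c; 0, 0, -y, x + y * b] with hW
  have hconj : Matrix.diagonal u.val * Matrix.vandermonde α =
      Matrix.vandermonde α * W.map (Int.castRingHom ℂ) := by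
    ext i s
    rw [Matrix.diagonal_mul, hu, Matrix.mul_apply, Fin.sum_univ_four]
    fin_cases s
    · simp [hW, Matrix.vandermonde_apply]
      ring
    · simp [hW, Matrix.vandermonde_apply]
      ring
    · simp [hW, Matrix.vandermonde_apply]
      ring
    · simp [hW, Matrix.vandermonde_apply]
      linear_combination (-(y : ℂ)) * h.root i
  have hdet : ((W.det : ℤ) : ℂ) = ∏ i, ((x : ℂ) - α i * y) := by
    have h1 := congrArg Matrix.det hconj
    rw [Matrix.det_mul, Matrix.det_mul, Matrix.det_diagonal, mul_comm] at h1
    have h2 := mul_left_cancel₀ (Matrix.det_vandermonde_ne_zero_iff.2 hinj) h1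
    have h3 := Int.cast_det (R := ℂ) W
    rw [h3, ← Finset.prod_congr rfl fun i _ => hu i, h2]
    rfl
  have hunit : IsUnit W := by
    rw [Matrix.isUnit_iff_isUnit_det, Int.isUnit_iff_natAbs_eq]
    have : ‖((W.det : ℤ) : ℂ)‖ = 1 := by rw [hdet, hxy]
    rw [Complex.norm_intCast] at this
    have h2 : |W.det| = 1 := by exact_mod_cast this
    rw [Int.abs_eq_natAbs] at h2
    exact_mod_cast h2
  exact ⟨hunit.unit, hconj⟩

end

theorem norm_pow_sub_one_bounds {z : ℂ} {m : ℕ} (h : m * ‖z - 1‖ ≤ 1 / 4) :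
    m * ‖z - 1‖ ≤ 2 * ‖z ^ m - 1‖ ∧ ‖z ^ m - 1‖ ≤ 2 * (m * ‖z - 1‖) := by
  have key : ∀ k ≤ m, ‖z ^ k - 1 - k * (z - 1)‖ ≤ k / 2 * ‖z - 1‖ := by
    intro k
    induction k with
    | zero => simp
    | succ k ih =>
      intro hk
      have h1 := ih (by omega)
      have h2 : k * ‖z - 1‖ ≤ 1 / 4 := by
        have : (k : ℝ) ≤ m := by exact_mod_cast (by omega : k ≤ m)
        nlinarith [norm_nonneg (z - 1)]
      have h3 : ‖z ^ k - 1‖ ≤ 1 / 2 := by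
        calc ‖z ^ k - 1‖ = ‖(z ^ k - 1 - k * (z - 1)) + k * (z - 1)‖ := by congr 1; ring
          _ ≤ ‖z ^ k - 1 - k * (z - 1)‖ + ‖(k : ℂ) * (z - 1)‖ := norm_add_le _ _
          _ = ‖z ^ k - 1 - k * (z - 1)‖ + k * ‖z - 1‖ := by
              rw [norm_mul, Complex.norm_natCast]
          _ ≤ 1 / 2 := by linarith
      calc ‖z ^ (k + 1) - 1 - (k + 1 : ℕ) * (z - 1)‖
          = ‖(z ^ k - 1 - k * (z - 1)) + (z ^ k - 1) * (z - 1)‖ := by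
            congr 1
            push_cast
            ring
        _ ≤ ‖z ^ k - 1 - k * (z - 1)‖ + ‖(z ^ k - 1) * (z - 1)‖ := norm_add_le _ _
        _ = ‖z ^ k - 1 - k * (z - 1)‖ + ‖z ^ k - 1‖ * ‖z - 1‖ := by rw [norm_mul]
        _ ≤ k / 2 * ‖z - 1‖ + 1 / 2 * ‖z - 1‖ := by gcongr
        _ = _ := by push_cast; ring
  have h1 := key m le_rfl
  have h2 : ‖(m : ℂ) * (z - 1)‖ = m * ‖z - 1‖ := by rw [norm_mul, Complex.norm_natCast]
  have h3 := norm_sub_norm_le ((m : ℂ) * (z - 1)) (z ^ m - 1)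
  have h4 := norm_sub_norm_le (z ^ m - 1) ((m : ℂ) * (z - 1))
  rw [norm_sub_rev ((m : ℂ) * (z - 1)) (z ^ m - 1)] at h3
  have h5 : 0 ≤ m * ‖z - 1‖ := by positivity
  constructor <;> linarith

theorem abs_log_norm_le {z : ℂ} {ε : ℝ} (hz : ‖z - 1‖ ≤ ε) (hε : ε ≤ 1 / 2) :
    |Real.log ‖z‖| ≤ 2 * ε := by
  have h1 : 1 - ε ≤ ‖z‖ := by
    have := norm_sub_norm_le 1 (1 - z)
    rw [sub_sub_cancel, norm_one, norm_sub_rev] at this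
    linarith
  have h2 : ‖z‖ ≤ 1 + ε := by
    have := norm_sub_norm_le z 1
    rw [norm_one] at this
    linarith
  have h0 : 0 < ‖z‖ := by linarith
  rw [abs_le]
  constructor
  · have := Real.one_sub_inv_le_log_of_pos h0
    have h3 : ‖z‖⁻¹ ≤ 1 + 2 * ε := by
      rw [inv_le_comm₀ h0 (by linarith [(norm_nonneg _).trans hz]), inv_le_iff_one_le_mul₀
        (by linarith [(norm_nonneg _).trans hz])]
      nlinarith [(norm_nonneg _).trans hz]
    linarith
  · have := Real.log_le_sub_one_of_pos h0
    linarith [(norm_nonneg _).trans hz]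

/-- Evaluation of a tuple of units, followed by the logarithm of the absolute value. -/
noncomputable def logNorm (u : (Fin 4 → ℂ)ˣ) (i : Fin 4) : ℝ := Real.log ‖u.val i‖

theorem units_apply_ne_zero (u : (Fin 4 → ℂ)ˣ) (i : Fin 4) : u.val i ≠ 0 := by
  have := congrFun u.mul_inv i
  exact left_ne_zero_of_mul_eq_one this

theorem units_zpow_apply (u : (Fin 4 → ℂ)ˣ) (a : ℤ) (i : Fin 4) :
    (u ^ a).val i = u.val i ^ a := by
  simp

theorem logNorm_zpow_mul_zpow (u v : (Fin 4 → ℂ)ˣ) (a b : ℤ) (i : Fin 4) :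
    logNorm (u ^ a * v ^ b) i = a * logNorm u i + b * logNorm v i := by
  simp only [logNorm]
  rw [Units.val_mul, Pi.mul_apply, units_zpow_apply, units_zpow_apply, norm_mul, norm_zpow,
    norm_zpow, Real.log_mul, Real.log_zpow, Real.log_zpow]
  · exact zpow_ne_zero _ (norm_ne_zero_iff.2 (units_apply_ne_zero u i))
  · exact zpow_ne_zero _ (norm_ne_zero_iff.2 (units_apply_ne_zero v i))

/-- If two numbers of a multiplicatively bounded family of pairs are close to `1` in the last
three coordinates, `η ^ a * η' ^ b` stays bounded when its first coordinate does. -/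
theorem norm_zpow_mul_zpow_le {η η' : (Fin 4 → ℂ)ˣ} {ε : ℝ} (hε : ε ≤ 1 / 2)
    (h1 : ∑ i, logNorm η i = 0) (h1' : ∑ i, logNorm η' i = 0)
    (hη : ∀ i ≠ 0, ∀ j ≠ 0, ‖η.val i / η.val j - 1‖ ≤ ε)
    (hη' : ∀ i ≠ 0, ∀ j ≠ 0, ‖η'.val i / η'.val j - 1‖ ≤ ε) {a b : ℤ}
    (hab : 2 * ε * (|(a : ℝ)| + |(b : ℝ)|) ≤ 1 / 10)
    (h0 : |a * logNorm η 0 + b * logNorm η' 0| ≤ 1 / 2) (i : Fin 4) :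
    ‖(η ^ a * η' ^ b).val i‖ ≤ 2 := by
  have hd : ∀ {ζ : (Fin 4 → ℂ)ˣ}, (∀ i ≠ 0, ∀ j ≠ 0, ‖ζ.val i / ζ.val j - 1‖ ≤ ε) →
      ∀ i ≠ 0, ∀ j ≠ 0, |logNorm ζ i - logNorm ζ j| ≤ 2 * ε := by
    intro ζ hζ i hi j hj
    have := abs_log_norm_le (hζ i hi j hj) hε
    rwa [norm_div, Real.log_div] at this
    · exact norm_ne_zero_iff.2 (units_apply_ne_zero ζ i)
    · exact norm_ne_zero_iff.2 (units_apply_ne_zero ζ j)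
  set u := η ^ a * η' ^ b with hu
  have hL : ∀ i, logNorm u i = a * logNorm η i + b * logNorm η' i :=
    logNorm_zpow_mul_zpow η η' a b
  have hdiff : ∀ i ≠ 0, ∀ j ≠ 0, |logNorm u i - logNorm u j| ≤ 1 / 10 := by
    intro i hi j hj
    rw [hL, hL]
    calc _ = |a * (logNorm η i - logNorm η j) + b * (logNorm η' i - logNorm η' j)| := by
          congr 1; ring
      _ ≤ |(a : ℝ)| * |logNorm η i - logNorm η j| + |(b : ℝ)| * |logNorm η' i - logNorm η' j| := by
          rw [← abs_mul, ← abs_mul]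
          exact abs_add_le _ _
      _ ≤ |(a : ℝ)| * (2 * ε) + |(b : ℝ)| * (2 * ε) := by
          gcongr
          · exact hd hη i hi j hj
          · exact hd hη' i hi j hj
      _ ≤ 1 / 10 := by linarith
  have hsum : ∑ i, logNorm u i = 0 := by
    simp_rw [hL]
    rw [Finset.sum_add_distrib, ← Finset.mul_sum, ← Finset.mul_sum, h1, h1']
    simp
  rw [← hL, abs_le] at h0
  rw [Fin.sum_univ_four] at hsum
  have h12 := abs_le.1 (hdiff 1 (by decide) 2 (by decide))
  have h13 := abs_le.1 (hdiff 1 (by decide) 3 (by decide))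
  have h23 := abs_le.1 (hdiff 2 (by decide) 3 (by decide))
  have hlog : logNorm u i ≤ 1 / 2 := by
    fin_cases i <;> simp only [Fin.zero_eta, Fin.mk_one, Fin.reduceFinMk] <;> linarith
  have hpos : 0 < ‖u.val i‖ := norm_pos_iff.2 (units_apply_ne_zero u i)
  have : Real.log ‖u.val i‖ ≤ Real.log 2 := by
    have := Real.log_two_gt_d9
    have h : logNorm u i = Real.log ‖u.val i‖ := rfl
    linarith
  exact (Real.log_le_log_iff hpos two_pos).1 this

theorem exists_zpow_mul_zpow_eq_one {S : Finset ℂ} {G : Subgroup (Fin 4 → ℂ)ˣ}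
    (hG : ∀ u ∈ G, (∀ i, ‖u.val i‖ ≤ 2) → ∀ i, u.val i ∈ S) {η η' : (Fin 4 → ℂ)ˣ}
    (hηG : η ∈ G) (hηG' : η' ∈ G) {ε ℓ ℓ' : ℝ}
    (h1 : ∑ i, logNorm η i = 0) (h1' : ∑ i, logNorm η' i = 0)
    (hη : ∀ i ≠ 0, ∀ j ≠ 0, ‖η.val i / η.val j - 1‖ ≤ ε)
    (hη' : ∀ i ≠ 0, ∀ j ≠ 0, ‖η'.val i / η'.val j - 1‖ ≤ ε)
    (h0 : logNorm η 0 = -ℓ) (h0' : logNorm η' 0 = -ℓ') (hℓ : 1 ≤ ℓ) (hℓ' : ℓ ≤ ℓ')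
    (hε : 40 * (3 * (S.card : ℝ) ^ 4 + 1) * (ℓ' * ε) ≤ 1) :
    ∃ m b : ℕ, 0 < b ∧ b ≤ m ∧ m * ε ≤ 1 / 4 ∧ η ^ m = η' ^ b := by
  classical
  have hε0 : 0 ≤ ε := (norm_nonneg _).trans (hη 1 (by decide) 1 (by decide))
  set M : ℝ := (S.card : ℝ) ^ 4 with hM
  have hM0 : 0 ≤ M := by positivity
  have hℓ0' : 0 ≤ ℓ' := by linarith
  have hℓ'ε : 0 ≤ ℓ' * ε := by positivity
  have hε2 : ε ≤ 1 / 2 := by nlinarith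
  set K : ℕ := ⌈2 * ℓ⌉₊ with hK
  have hK3 : (K : ℝ) ≤ 3 * ℓ := by
    have := Nat.ceil_lt_add_one (show 0 ≤ 2 * ℓ by linarith)
    linarith
  set N : ℕ := S.card ^ 4 * K with hN
  have hN3 : (N : ℝ) + 1 ≤ (3 * M + 1) * ℓ := by
    have : (N : ℝ) = M * K := by rw [hN, hM]; push_cast; ring
    rw [this]
    nlinarith
  set ψ : ℕ → ℝ := fun t => ℓ * Int.fract (t * ℓ' / ℓ) with hψ
  have hψ0 : ∀ t, 0 ≤ ψ t := fun t => mul_nonneg (by linarith) (Int.fract_nonneg _)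
  have hψ1 : ∀ t, ψ t < ℓ := fun t => by
    have := Int.fract_lt_one (t * ℓ' / ℓ)
    simp only [hψ]
    nlinarith
  obtain ⟨k, -, hk⟩ := Finset.exists_lt_card_fiber_of_mul_lt_card_of_maps_to
    (s := Finset.range (N + 1)) (t := Finset.range K) (f := fun t => ⌊2 * ψ t⌋₊)
    (n := S.card ^ 4)
    (fun t _ => by
      rw [Finset.mem_range, Nat.floor_lt (by linarith [hψ0 t])]
      exact lt_of_lt_of_le (by linarith [hψ1 t]) (Nat.le_ceil _))
    (by simp only [Finset.card_range]; rw [mul_comm]; omega)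
  set B := {t ∈ Finset.range (N + 1) | ⌊2 * ψ t⌋₊ = k} with hB
  have hBmem : ∀ t ∈ B, t ≤ N ∧ ⌊2 * ψ t⌋₊ = k := fun t ht => by
    rw [hB, Finset.mem_filter, Finset.mem_range] at ht
    exact ⟨by omega, ht.2⟩
  set A : ℕ → ℤ := fun t => ⌊t * ℓ' / ℓ⌋ with hA
  have hAψ : ∀ t, ψ t = t * ℓ' - A t * ℓ := fun t => by
    simp only [hψ, hA, Int.fract]
    field_simp
  have hclose : ∀ s ∈ B, ∀ t ∈ B, |ψ s - ψ t| ≤ 1 / 2 := fun s hs t ht => by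
    have e1 := (Nat.floor_eq_iff (by linarith [hψ0 s])).1 (hBmem s hs).2
    have e2 := (Nat.floor_eq_iff (by linarith [hψ0 t])).1 (hBmem t ht).2
    rw [abs_le]
    constructor <;> linarith
  have hbB : ∀ s ∈ B, ∀ t ∈ B, |((s : ℝ) - t)| ≤ N := fun s hs t ht => by
    have e1 : (s : ℝ) ≤ N := by exact_mod_cast (hBmem s hs).1
    have e2 : (t : ℝ) ≤ N := by exact_mod_cast (hBmem t ht).1
    rw [abs_le]
    constructor <;> linarith [(Nat.cast_nonneg s : (0 : ℝ) ≤ s), (Nat.cast_nonneg t : (0 : ℝ) ≤ t)]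
  have haB : ∀ s ∈ B, ∀ t ∈ B, |((A s : ℝ) - A t)| ≤ (3 * M + 1) * ℓ' := fun s hs t ht => by
    have e : ((A s : ℝ) - A t) * ℓ = (s - t) * ℓ' - (ψ s - ψ t) := by
      rw [hAψ, hAψ]; ring
    have e2 : |((A s : ℝ) - A t)| * ℓ ≤ N * ℓ' + 1 / 2 := by
      calc |((A s : ℝ) - A t)| * ℓ = |((A s : ℝ) - A t) * ℓ| := by
            rw [abs_mul, abs_of_pos (by linarith : 0 < ℓ)]
        _ ≤ |(s - t) * ℓ'| + |ψ s - ψ t| := by rw [e]; exact abs_sub _ _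
        _ = |((s : ℝ) - t)| * ℓ' + |ψ s - ψ t| := by
            rw [abs_mul, abs_of_pos (by linarith : 0 < ℓ')]
        _ ≤ _ := by
            gcongr
            · exact hbB s hs t ht
            · exact hclose s hs t ht
    have e3 : |((A s : ℝ) - A t)| * ℓ ≤ ((3 * M + 1) * ℓ') * ℓ := by nlinarith
    exact le_of_mul_le_mul_right e3 (by linarith)
  have hBne : B.Nonempty := Finset.card_pos.1 (by omega)
  obtain ⟨t₀, ht₀⟩ := hBne
  set U : ℕ → (Fin 4 → ℂ)ˣ := fun t => η ^ (A t₀ - A t) * η' ^ ((t : ℤ) - t₀) with hU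
  have hUS : ∀ t ∈ B, (U t).val ∈ Fintype.piFinset fun _ : Fin 4 => S := fun t ht => by
    rw [Fintype.mem_piFinset]
    refine hG _ (G.mul_mem (G.zpow_mem hηG _) (G.zpow_mem hηG' _)) fun i => ?_
    refine norm_zpow_mul_zpow_le hε2 h1 h1' hη hη' ?_ ?_ i
    · push_cast
      have e1 := haB t₀ ht₀ t ht
      have e2 := hbB t ht t₀ ht₀
      have e3 : |((A t₀ : ℝ) - A t)| + |((t : ℝ) - t₀)| ≤ 2 * ((3 * M + 1) * ℓ') := by nlinarith
      calc _ ≤ 2 * ε * (2 * ((3 * M + 1) * ℓ')) := by gcongr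
        _ ≤ 1 / 10 := by linarith
    · rw [h0, h0']
      have := hclose t₀ ht₀ t ht
      rw [hAψ, hAψ] at this
      push_cast
      convert this using 2
      ring
  obtain ⟨s, hs, t, ht, hst, hEq⟩ := Finset.exists_ne_map_eq_of_card_lt_of_maps_to
    (s := B) (t := Fintype.piFinset fun _ : Fin 4 => S) (f := fun t => (U t).val)
    (by simpa [Fintype.card_piFinset] using hk) hUS
  wlog hlt : s < t generalizing s t
  · exact this t ht s hs hst.symm hEq.symm (by omega)
  have hEq' : η ^ (A t - A s) = η' ^ ((t : ℤ) - s) := by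
    have e := Units.ext hEq
    simp only [hU] at e
    have e1 : A t - A s = (A t₀ - A s) - (A t₀ - A t) := by ring
    have e2 : (t : ℤ) - s = (t - t₀) - (s - t₀) := by ring
    rw [e1, e2, zpow_sub, zpow_sub η', ← div_eq_mul_inv, ← div_eq_mul_inv, div_eq_div_iff_mul_eq_mul,
      e, mul_comm]
  have hlog : ((A t - A s : ℤ) : ℝ) * ℓ = ((t : ℤ) - s : ℤ) * ℓ' := by
    have e1 := logNorm_zpow_mul_zpow η η' (A t - A s) 0 0
    have e2 := logNorm_zpow_mul_zpow η η' 0 ((t : ℤ) - s) 0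
    simp only [zpow_zero, one_mul, mul_one, Int.cast_zero, zero_mul, add_zero, zero_add] at e1 e2
    rw [hEq', e2, h0, h0'] at e1
    linarith
  have hge : (t : ℤ) - s ≤ A t - A s := by
    have hts : (0 : ℝ) < ((t : ℤ) - s : ℤ) := by exact_mod_cast (by omega : (0 : ℤ) < t - s)
    have : (((t : ℤ) - s : ℤ) : ℝ) ≤ ((A t - A s : ℤ) : ℝ) := by
      by_contra! hcon
      nlinarith
    exact_mod_cast this
  refine ⟨(A t - A s).toNat, t - s, by omega, by omega, ?_, ?_⟩
  · have e1 : (((A t - A s).toNat : ℕ) : ℝ) = A t - A s := by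
      have : (((A t - A s).toNat : ℕ) : ℤ) = A t - A s := Int.toNat_of_nonneg (by omega)
      exact_mod_cast this
    rw [e1]
    have e2 := (le_abs_self _).trans (haB t ht s hs)
    calc _ ≤ (3 * M + 1) * ℓ' * ε := by gcongr
      _ ≤ 1 / 4 := by linarith
  · rw [← zpow_natCast, ← zpow_natCast, Int.toNat_of_nonneg (by omega), hEq']
    congr 1
    omega

theorem norm_div_sub_one_le_of_pow_eq_pow {η η' : (Fin 4 → ℂ)ˣ} {ε : ℝ} {m b : ℕ} (hb : 0 < b)
    (hbm : b ≤ m) (hm : m * ε ≤ 1 / 4) (h : η ^ m = η' ^ b) {i j : Fin 4}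
    (hη : ‖η.val i / η.val j - 1‖ ≤ ε) (hη' : ‖η'.val i / η'.val j - 1‖ ≤ ε) :
    ‖η.val i / η.val j - 1‖ ≤ 4 * ‖η'.val i / η'.val j - 1‖ := by
  have hε0 : 0 ≤ ε := (norm_nonneg _).trans hη
  have hbm' : (b : ℝ) ≤ m := by exact_mod_cast hbm
  have hb' : (0 : ℝ) < b := by exact_mod_cast hb
  have e1 := (norm_pow_sub_one_bounds (z := η.val i / η.val j) (m := m)
    ((by gcongr : _ ≤ m * ε).trans hm)).1
  have e2 := (norm_pow_sub_one_bounds (z := η'.val i / η'.val j) (m := b)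
    ((by gcongr : _ ≤ m * ε).trans hm)).2
  have e3 : (η.val i / η.val j) ^ m = (η'.val i / η'.val j) ^ b := by
    have h' : ∀ i, η.val i ^ m = η'.val i ^ b := fun i => by
      have := congrFun (congrArg Units.val h) i
      simpa using this
    rw [div_pow, div_pow, h', h']
  rw [e3] at e1
  have e4 : (b : ℝ) * ‖η.val i / η.val j - 1‖ ≤ b * (4 * ‖η'.val i / η'.val j - 1‖) := by
    nlinarith [norm_nonneg (η.val i / η.val j - 1)]
  exact le_of_mul_le_mul_left e4 hb'

section

/-- The indices `i`, `j`, `k` are `1`, `2`, `3` in some order. -/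
def IsTriple (i j k : Fin 4) : Prop :=
  i ≠ 0 ∧ j ≠ 0 ∧ k ≠ 0 ∧ i ≠ j ∧ i ≠ k ∧ j ≠ k

instance (i j k : Fin 4) : Decidable (IsTriple i j k) :=
  inferInstanceAs (Decidable (_ ∧ _))

theorem exists_isTriple : ∀ i : Fin 4, i ≠ 0 → ∃ j k, IsTriple i j k := by decide

theorem exists_isTriple_of_ne : ∀ i j : Fin 4, i ≠ 0 → j ≠ 0 → i ≠ j → ∃ k, IsTriple i j k := by
  decide

theorem IsTriple.swap {i j k : Fin 4} (h : IsTriple i j k) : IsTriple i k j :=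
  ⟨h.1, h.2.2.1, h.2.1, h.2.2.2.2.1, h.2.2.2.1, h.2.2.2.2.2.symm⟩

theorem IsTriple.rotate {i j k : Fin 4} (h : IsTriple i j k) : IsTriple j k i :=
  ⟨h.2.1, h.2.2.1, h.1, h.2.2.2.2.2, h.2.2.2.1.symm, h.2.2.2.2.1.symm⟩

theorem IsTriple.prod_eq {R : Type*} [CommRing R] {i j k : Fin 4} (h : IsTriple i j k)
    (f : Fin 4 → R) : f i * f j * f k = f 1 * f 2 * f 3 := by
  revert h
  fin_cases i <;> fin_cases j <;> fin_cases k <;> simp [IsTriple] <;> ring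

/-- The absolute values `u i` of the determinants of the first of four complex linear forms with
the other three, when complementary determinants have the same absolute value. -/
structure IsFrame (u : Fin 4 → ℝ) : Prop where
  pos : ∀ i ≠ 0, 0 < u i
  sq_le : ∀ i j k, IsTriple i j k → u i ^ 2 ≤ u j ^ 2 + u k ^ 2

/-- The absolute values `X i` of the four forms at a solution where the first one is smallest. -/
structure IsSmallPoint (u X : Fin 4 → ℝ) : Prop where
  pos : ∀ i, 0 < X i
  prod : X 0 * (X 1 * X 2 * X 3) = 1
  min : ∀ i, X 0 ≤ X i
  tri : ∀ i j k, IsTriple i j k → X i * u j ≤ X j * u i + X 0 * u k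

theorem ratio_le_of_triangle {u v w R A B r a b : ℝ} (hu : 0 < u) (hv : 0 < v) (hw : 0 < w)
    (hv2 : v ^ 2 ≤ u ^ 2 + w ^ 2) (hw2 : w ^ 2 ≤ u ^ 2 + v ^ 2) (hr : 1 ≤ r) (hA : 1 ≤ A)
    (hB : 1 ≤ B) (ha : 0 ≤ a) (hb : 0 ≤ b) (hprod : R * A * B ≤ r * a * b)
    (h1 : R * v ≤ A * u + w) (h2 : a * u ≤ r * v + w) (h3 : R * w ≤ B * u + v)
    (h4 : b * u ≤ r * w + v) : R ≤ 10 * r := by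
  wlog hwv : w ≤ v generalizing v w A B a b
  · exact this hw hv hw2 hv2 hB hA hb ha (by linarith) h3 h4 h1 h2 (by linarith)
  by_contra! hR
  have hR0 : 0 ≤ R := by linarith
  have e1 : 9 * r * v ≤ A * u := by nlinarith
  have e2 : a * u ≤ 2 * r * v := by nlinarith
  have e3 : u ≤ B * u := by nlinarith
  have e4 : 10 * (r * w) - v ≤ B * u := by nlinarith
  have e5 : 45 * (B * u) ≤ r * w + v := by
    have f1 : (R * A * B) * (u * u) ≤ (r * a * b) * (u * u) := by gcongr
    have f2 : (10 * r) * (9 * r * v) * (B * u) ≤ R * (A * u) * (B * u) := by gcongr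
    have f3 : r * (a * u) * (b * u) ≤ r * (2 * r * v) * (r * w + v) := by gcongr
    have f4 : (2 * r * r * v) * (45 * (B * u)) ≤ (2 * r * r * v) * (r * w + v) := by nlinarith
    exact le_of_mul_le_mul_left f4 (by positivity)
  have e6 : w ≤ r * w := by nlinarith
  have e7 : 449 * w ≤ 46 * v := by linarith
  have e8 : 449 * (45 * u) ≤ 495 * v := by linarith
  nlinarith

variable {u X Y Z : Fin 4 → ℝ}

theorem IsSmallPoint.prod_triple (hX : IsSmallPoint u X) {i j k : Fin 4} (h : IsTriple i j k) :
    X 0 * (X i * X j * X k) = 1 := by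
  rw [h.prod_eq, hX.prod]

theorem IsSmallPoint.le_one (hX : IsSmallPoint u X) : X 0 ≤ 1 := by
  by_contra! h
  have h0 := hX.pos 0
  have := hX.prod
  have h1 : 1 < X 1 := h.trans_le (hX.min 1)
  have h2 : 1 < X 2 := h.trans_le (hX.min 2)
  have h3 : 1 < X 3 := h.trans_le (hX.min 3)
  nlinarith [mul_pos (sub_pos.2 h1) (sub_pos.2 h2), one_lt_mul_of_lt_of_le
    (one_lt_mul_of_lt_of_le h1 h2.le) h3.le]

theorem IsSmallPoint.mul_le_ten_mul (hu : IsFrame u) (hX : IsSmallPoint u X)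
    (hY : IsSmallPoint u Y) (h : Y 0 ≤ X 0) {i : Fin 4} (hi : i ≠ 0) :
    Y 0 * X i ≤ 10 * (X 0 * Y i) := by
  obtain ⟨j, k, hT⟩ := exists_isTriple i hi
  have hx := hX.pos 0
  have hy := hY.pos 0
  have p1 : X i / X 0 * (X j / X 0) * (X k / X 0) = (1 / X 0) ^ 4 := by
    have := hX.prod_triple hT
    field_simp
    linarith
  have p2 : Y i / Y 0 * (Y j / Y 0) * (Y k / Y 0) = (1 / Y 0) ^ 4 := by
    have := hY.prod_triple hT
    field_simp
    linarith
  have key := ratio_le_of_triangle (R := X i / X 0) (A := X j / X 0) (B := X k / X 0)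
    (r := Y i / Y 0) (a := Y j / Y 0) (b := Y k / Y 0) (hu.pos i hi) (hu.pos j hT.2.1)
    (hu.pos k hT.2.2.1) (by linarith [hu.sq_le _ _ _ hT.rotate])
    (by linarith [hu.sq_le _ _ _ hT.swap.rotate])
    ((one_le_div hy).2 (hY.min i)) ((one_le_div hx).2 (hX.min j)) ((one_le_div hx).2 (hX.min k))
    (div_pos (hY.pos j) hy).le (div_pos (hY.pos k) hy).le (by rw [p1, p2]; gcongr)
    (by have := hX.tri i j k hT; field_simp; linarith)
    (by have := hY.tri j i k hT.swap.rotate.rotate; field_simp; linarith)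
    (by have := hX.tri i k j hT.swap; field_simp; linarith)
    (by have := hY.tri k i j hT.rotate.rotate; field_simp; linarith)
  rw [div_le_iff₀ hx, mul_div_assoc', div_mul_eq_mul_div, le_div_iff₀ hy] at key
  linarith

theorem IsSmallPoint.det_mul_le (hu : IsFrame u) (hX : IsSmallPoint u X)
    (hY : IsSmallPoint u Y) (h : Y 0 ≤ X 0) {n : ℝ} {i : Fin 4} (hi : i ≠ 0)
    (hn : n * u i ≤ X 0 * Y i + Y 0 * X i) : n * u i ≤ 11 * (X 0 * Y i) := by
  linarith [hX.mul_le_ten_mul hu hY h hi]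

theorem IsSmallPoint.cube_mul_le (hu : IsFrame u) (hX : IsSmallPoint u X)
    (hY : IsSmallPoint u Y) (h : Y 0 ≤ X 0) {n : ℝ} (hn0 : 0 ≤ n)
    (hn : ∀ i ≠ 0, n * u i ≤ X 0 * Y i + Y 0 * X i) :
    n ^ 3 * (u 1 * u 2 * u 3) * Y 0 ≤ 1331 * X 0 ^ 3 := by
  have e := fun i (hi : i ≠ 0) => hX.det_mul_le hu hY h hi (hn i hi)
  have hx := (hX.pos 0).le
  have hp : ∀ i ≠ 0, 0 ≤ n * u i := fun i hi => mul_nonneg hn0 (hu.pos i hi).le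
  calc n ^ 3 * (u 1 * u 2 * u 3) * Y 0 = (n * u 1) * (n * u 2) * (n * u 3) * Y 0 := by ring
    _ ≤ (11 * (X 0 * Y 1)) * (11 * (X 0 * Y 2)) * (11 * (X 0 * Y 3)) * Y 0 := by
        have this' := (hY.pos 0).le
        have := (hY.pos 1).le
        have := (hY.pos 2).le
        have := (hY.pos 3).le
        refine mul_le_mul_of_nonneg_right (mul_le_mul (mul_le_mul (e 1 (by decide))
          (e 2 (by decide)) (hp 2 (by decide)) ?_) (e 3 (by decide)) (hp 3 (by decide)) ?_) this'
        all_goals positivity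
    _ = 1331 * X 0 ^ 3 * (Y 0 * (Y 1 * Y 2 * Y 3)) := by ring
    _ = _ := by rw [hY.prod, mul_one]

/-- The second point of a class already controls the frame. -/
theorem IsSmallPoint.sq_mul_sq_le (hu : IsFrame u) (hX : IsSmallPoint u X)
    (h : ∀ i ≠ 0, u i ≤ 11 * X i) {i : Fin 4} (hi : i ≠ 0) : X 0 ^ 2 * u i ^ 2 ≤ 242 := by
  have hx := (hX.pos 0)
  have key : ∀ {i j k}, IsTriple i j k → X 0 ^ 2 * (u i * u j) ≤ 121 := by
    intro i j k hT
    have := hu.pos i hT.1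
    have := hu.pos j hT.2.1
    have := hX.pos i
    have := hX.pos j
    calc X 0 ^ 2 * (u i * u j) = X 0 * (u i * u j * X 0) := by ring
      _ ≤ X 0 * ((11 * X i) * (11 * X j) * X k) := by
          gcongr
          · exact h i hT.1
          · exact h j hT.2.1
          · exact hX.min k
      _ = 121 * (X 0 * (X i * X j * X k)) := by ring
      _ = 121 := by rw [hX.prod_triple hT, mul_one]
  obtain ⟨j, k, hT⟩ := exists_isTriple i hi
  have hui := hu.pos i hi
  have huj := hu.pos j hT.2.1
  have huk := hu.pos k hT.2.2.1
  have h1 := key hT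
  have h2 := key hT.swap
  have h3 : u i ≤ u j + u k := by
    have := hu.sq_le _ _ _ hT
    nlinarith
  have h4 : X 0 ^ 2 * (u i * u i) ≤ X 0 ^ 2 * (u i * (u j + u k)) := by gcongr
  nlinarith

/-- Points whose smallest form is small enough are almost proportional to the frame. -/
theorem IsSmallPoint.mul_le_two_mul (hX : IsSmallPoint u X) {i j k : Fin 4} (hT : IsTriple i j k)
    (h : 2 * (X 0 * u k) ≤ X i * u j) : X i * u j ≤ 2 * (X j * u i) := by
  linarith [hX.tri i j k hT]

/-- After the second point of a class, the ratios of consecutive points are close to `1`. -/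
theorem IsSmallPoint.det_mul_le_sqrt (hu : IsFrame u) (hX : IsSmallPoint u X)
    (hY : IsSmallPoint u Y) (hYX : Y 0 ≤ X 0) {l n : ℝ} (hl : 0 < l) (hl1 : l ≤ 1)
    (hlu : ∀ i ≠ 0, l ^ 2 * u i ^ 2 ≤ 242) (hX1 : ∀ i ≠ 0, u i ≤ 11 * (l * X i))
    (hX0 : (u 1 * u 2 * u 3) * X 0 ≤ 1331 * l ^ 3) (hΔ : 3000000 ≤ u 1 * u 2 * u 3)
    (hn0 : 0 ≤ n) (hn : ∀ i ≠ 0, n * u i ≤ X 0 * Y i + Y 0 * X i) {i j k : Fin 4}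
    (hT : IsTriple i j k) : n * u k ≤ √(X 0) * (X i * Y j) := by
  have hx := hX.pos 0
  set Δ := u 1 * u 2 * u 3 with hΔdef
  have hΔ' : u i * u j * u k = Δ := hT.prod_eq u
  have hui := hu.pos i hT.1
  have huj := hu.pos j hT.2.1
  have huk := hu.pos k hT.2.2.1
  have hXi := hX.pos i
  have hYj := hY.pos j
  have h1 := hX1 i hT.1
  have h2 := hX.det_mul_le hu hY hYX hT.2.1 (hn j hT.2.1)
  have h3 := hlu k hT.2.2.1
  have hs : 0 < √(X 0) := Real.sqrt_pos.2 hx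
  have hss : √(X 0) * √(X 0) = X 0 := Real.mul_self_sqrt hx.le
  have h4 : 29282 * √(X 0) ≤ l * Δ := by
    refine abs_le_of_sq_le_sq' ?_ (by positivity) |>.2
    have e1 : l ^ 3 ≤ l ^ 2 := by nlinarith [sq_nonneg l]
    have e2 : Δ ^ 2 ≥ 3000000 ^ 2 := by nlinarith
    have e3 : X 0 ≤ l ^ 2 := by nlinarith
    calc (29282 * √(X 0)) ^ 2 = 29282 ^ 2 * X 0 := by rw [mul_pow, sq (√_), hss]
      _ ≤ 29282 ^ 2 * l ^ 2 := by gcongr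
      _ ≤ l ^ 2 * Δ ^ 2 := by nlinarith [sq_nonneg l]
      _ = _ := by ring
  have h5 : (n * u k) * (l * Δ) ≤ (√(X 0) * (X i * Y j)) * (l * Δ) :=
    calc (n * u k) * (l * Δ) = u i * (n * u j) * (l * u k ^ 2) := by rw [← hΔ']; ring
      _ ≤ (11 * (l * X i)) * (11 * (X 0 * Y j)) * (l * u k ^ 2) := by gcongr
      _ = 121 * (X i * Y j) * X 0 * (l ^ 2 * u k ^ 2) := by ring
      _ ≤ 121 * (X i * Y j) * X 0 * 242 := by gcongr
      _ = √(X 0) * (X i * Y j) * (29282 * √(X 0)) := by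
          nth_rw 1 [← hss]; ring
      _ ≤ _ := by gcongr
  exact le_of_mul_le_mul_right h5 (mul_pos hl (by linarith))

theorem IsSmallPoint.mul_le_two_mul_of_le (hu : IsFrame u) (hX : IsSmallPoint u X) {l : ℝ}
    (hl : 0 < l) (hXl : X 0 ≤ l)
    (hlu : ∀ i ≠ 0, l ^ 2 * u i ^ 2 ≤ 242) (hX1 : ∀ i ≠ 0, u i ≤ 11 * (l * X i))
    (hΔ : 3000000 ≤ u 1 * u 2 * u 3) {i j k : Fin 4} (hT : IsTriple i j k) :
    X i * u j ≤ 2 * (X j * u i) := by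
  refine hX.mul_le_two_mul hT ?_
  have hui := hu.pos i hT.1
  have huj := hu.pos j hT.2.1
  have huk := hu.pos k hT.2.2.1
  have h3 := hlu k hT.2.2.1
  have hx := hX.pos 0
  rw [← hT.prod_eq u] at hΔ
  have h5 : (2 * (X 0 * u k)) * (11 * l * u k) ≤ (X i * u j) * (11 * l * u k) :=
    calc (2 * (X 0 * u k)) * (11 * l * u k) ≤ (2 * (l * u k)) * (11 * l * u k) := by gcongr
      _ = 22 * (l ^ 2 * u k ^ 2) := by ring
      _ ≤ u i * u j * u k := by linarith
      _ ≤ (11 * (l * X i)) * u j * u k := by gcongr; exact hX1 i hT.1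
      _ = _ := by ring
  exact le_of_mul_le_mul_right h5 (by positivity)

/-- Three consecutive points cannot have comparable ratios. -/
theorem IsSmallPoint.false_of_comparable (hu : IsFrame u) (hX : IsSmallPoint u X)
    (hY : IsSmallPoint u Y) (hZ : IsSmallPoint u Z) (hYX : Y 0 ≤ X 0) (hZY : Z 0 ≤ Y 0)
    {l n n' : ℝ} (hl : 0 < l) (hXl : X 0 ≤ l)
    (hlu : ∀ i ≠ 0, l ^ 2 * u i ^ 2 ≤ 242) (hX1 : ∀ i ≠ 0, u i ≤ 11 * (l * X i))
    (hY1 : ∀ i ≠ 0, u i ≤ 11 * (l * Y i)) (hΔ : 3000000 ≤ u 1 * u 2 * u 3)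
    (hn1 : 1 ≤ n) (hn' : ∀ i ≠ 0, n' * u i ≤ Y 0 * Z i + Z 0 * Y i)
    (hcomp : n * u 3 / (X 1 * Y 2) ≤ 4 * (n' * u 3 / (Y 1 * Z 2))) : False := by
  have hu1 := hu.pos 1 (by decide)
  have hu2 := hu.pos 2 (by decide)
  have hu3 := hu.pos 3 (by decide)
  have hX1p := hX.pos 1
  have hX0p := hX.pos 0
  have hX2p := hX.pos 2
  have hX3p := hX.pos 3
  have hY1p := hY.pos 1
  have hY0p := hY.pos 0
  have hY2p := hY.pos 2
  have hZ2p := hZ.pos 2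
  have e1 : n * (Y 1 * Z 2) ≤ 4 * n' * (X 1 * Y 2) := by
    rw [mul_div_assoc', div_le_div_iff₀ (by positivity) (by positivity)] at hcomp
    have : (n * (Y 1 * Z 2)) * u 3 ≤ (4 * n' * (X 1 * Y 2)) * u 3 := by linarith
    exact le_of_mul_le_mul_right this hu3
  have e2 := hY.det_mul_le hu hZ hZY (i := 2) (by decide) (hn' 2 (by decide))
  have e3 := hY.mul_le_two_mul_of_le hu hl (hYX.trans hXl) hlu hY1 hΔ
    (i := 2) (j := 1) (k := 3) (by decide)
  have e4 : u 1 ≤ 88 * (Y 0 * X 1) := by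
    have : u 1 * (u 2 * Y 1 * Z 2) ≤ 88 * (Y 0 * X 1) * (u 2 * Y 1 * Z 2) :=
      calc u 1 * (u 2 * Y 1 * Z 2) = 1 * (Y 1 * Z 2) * (u 1 * u 2) := by ring
        _ ≤ n * (Y 1 * Z 2) * (u 1 * u 2) := by gcongr
        _ ≤ 4 * n' * (X 1 * Y 2) * (u 1 * u 2) := by gcongr
        _ = 4 * (n' * u 2) * (X 1) * (Y 2 * u 1) := by ring
        _ ≤ 4 * (11 * (Y 0 * Z 2)) * (X 1) * (Y 2 * u 1) := by gcongr
        _ ≤ 4 * (11 * (Y 0 * Z 2)) * (X 1) * (2 * (Y 1 * u 2)) := by gcongr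
        _ = _ := by ring
    exact le_of_mul_le_mul_right this (by positivity)
  have f2 := hX.mul_le_two_mul_of_le hu hl hXl hlu hX1 hΔ (i := 1) (j := 2) (k := 3) (by decide)
  have f3 := hX.mul_le_two_mul_of_le hu hl hXl hlu hX1 hΔ (i := 1) (j := 3) (k := 2) (by decide)
  have f4 : X 0 * (u 1 * u 2 * u 3) * X 1 ^ 3 ≤ 4 * u 1 ^ 3 :=
    calc X 0 * (u 1 * u 2 * u 3) * X 1 ^ 3
        = X 0 * u 1 * X 1 * (X 1 * u 2) * (X 1 * u 3) := by ring
      _ ≤ X 0 * u 1 * X 1 * (2 * (X 2 * u 1)) * (2 * (X 3 * u 1)) := by gcongr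
      _ = 4 * u 1 ^ 3 * (X 0 * (X 1 * X 2 * X 3)) := by ring
      _ = _ := by rw [hX.prod, mul_one]
  have f5 : X 0 * (u 1 * u 2 * u 3) * X 1 ^ 3 ≤ 4 * (88 ^ 3 * X 0) * X 1 ^ 3 :=
    calc X 0 * (u 1 * u 2 * u 3) * X 1 ^ 3 ≤ 4 * u 1 ^ 3 := f4
      _ ≤ 4 * (88 * (Y 0 * X 1)) ^ 3 := by gcongr
      _ ≤ 4 * (88 * (X 0 * X 1)) ^ 3 := by gcongr
      _ = 4 * (88 ^ 3 * (X 0 * (X 0 * X 0))) * X 1 ^ 3 := by ring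
      _ ≤ 4 * (88 ^ 3 * (X 0 * (1 * 1))) * X 1 ^ 3 := by gcongr <;> exact hX.le_one
      _ = _ := by ring
  have f6 := le_of_mul_le_mul_right f5 (by positivity)
  nlinarith

end

section

/-- The weighted absolute values of the four linear forms `x - α i * y` at an integral point. -/
noncomputable def formAbs (α : Fin 4 → ℂ) (w : Fin 4 → ℝ) (p : ℤ × ℤ) (i : Fin 4) : ℝ :=
  w i * ‖(p.1 : ℂ) - α i * p.2‖

/-- The absolute values of the determinants of the first weighted form with the others. -/
noncomputable def frameAbs (α : Fin 4 → ℂ) (w : Fin 4 → ℝ) (i : Fin 4) : ℝ :=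
  w 0 * w i * ‖α 0 - α i‖

/-- Weights on the linear forms such that complementary determinants have equal absolute values. -/
structure IsBalanced (α : Fin 4 → ℂ) (w : Fin 4 → ℝ) : Prop where
  inj : Function.Injective α
  pos : ∀ i, 0 < w i
  prod : w 0 * (w 1 * w 2 * w 3) = 1
  eq : ∀ i j k, IsTriple i j k → w 0 * w k * ‖α 0 - α k‖ = w i * w j * ‖α i - α j‖

/-- Solutions of the Thue equation at which the first weighted form is smallest. -/
structure IsClassPoint (α : Fin 4 → ℂ) (w : Fin 4 → ℝ) (p : ℤ × ℤ) : Prop where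
  prod : ∏ i, ‖(p.1 : ℂ) - α i * p.2‖ = 1
  min : ∀ i, formAbs α w p 0 ≤ formAbs α w p i

variable {α : Fin 4 → ℂ} {w : Fin 4 → ℝ}

theorem norm_pos_of_prod_eq_one {β : Fin 4 → ℂ} (h : ∏ i, ‖β i‖ = 1) (i : Fin 4) : 0 < ‖β i‖ := by
  refine lt_of_le_of_ne (norm_nonneg _) fun h0 => ?_
  rw [Finset.prod_eq_zero (Finset.mem_univ i) h0.symm] at h
  exact zero_ne_one h

theorem IsClassPoint.norm_pos {p : ℤ × ℤ} (h : IsClassPoint α w p) (i : Fin 4) :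
    0 < ‖(p.1 : ℂ) - α i * p.2‖ :=
  norm_pos_of_prod_eq_one (β := fun i => (p.1 : ℂ) - α i * p.2) h.prod i

theorem IsBalanced.isFrame (h : IsBalanced α w) : IsFrame (frameAbs α w) := by
  have hsq : ∀ i j k, IsTriple i j k → frameAbs α w k ^ 2 = ‖(α 0 - α k) * (α i - α j)‖ := by
    intro i j k hT
    have h1 := h.eq i j k hT
    have h2 : w 0 * (w i * w j * w k) = 1 := by rw [hT.prod_eq w, h.prod]
    rw [norm_mul, sq, frameAbs]
    nth_rw 2 [h1]
    linear_combination (‖α 0 - α k‖ * ‖α i - α j‖) * h2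
  refine ⟨fun i hi => ?_, fun i j k hT => ?_⟩
  · have := norm_pos_iff.2 (sub_ne_zero.2 (h.inj.ne hi.symm))
    have := h.pos i
    have := h.pos 0
    unfold frameAbs
    positivity
  · rw [hsq j k i hT.rotate, hsq i k j hT.swap, hsq i j k hT, add_comm]
    have : (α 0 - α i) * (α j - α k) =
        (α 0 - α j) * (α i - α k) - (α 0 - α k) * (α i - α j) := by ring
    rw [this, add_comm]
    exact norm_sub_le _ _

theorem IsBalanced.det_le (h : IsBalanced α w) (p q : ℤ × ℤ) (i j : Fin 4) :
    |((p.1 * q.2 - p.2 * q.1 : ℤ) : ℝ)| * (w i * w j * ‖α i - α j‖) ≤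
      formAbs α w p i * formAbs α w q j + formAbs α w q i * formAbs α w p j := by
  have e : ((p.1 * q.2 - p.2 * q.1 : ℤ) : ℂ) * (α j - α i) =
      (p.1 - α i * p.2) * (q.1 - α j * q.2) * (-1) + (q.1 - α i * q.2) * (p.1 - α j * p.2) := by
    push_cast; ring
  have e2 : |((p.1 * q.2 - p.2 * q.1 : ℤ) : ℝ)| = ‖((p.1 * q.2 - p.2 * q.1 : ℤ) : ℂ)‖ := by
    rw [Complex.norm_intCast]
  have hi := (h.pos i).le
  have hj := (h.pos j).le
  calc _ = w i * w j * ‖((p.1 * q.2 - p.2 * q.1 : ℤ) : ℂ) * (α j - α i)‖ := by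
        rw [e2, norm_mul, norm_sub_rev (α j)]; ring
    _ ≤ w i * w j * (‖(p.1 - α i * p.2) * (q.1 - α j * q.2) * (-1)‖ +
          ‖(q.1 - α i * q.2) * (p.1 - α j * p.2)‖) := by
        rw [e]; gcongr; exact norm_add_le _ _
    _ = _ := by simp only [formAbs, norm_mul, norm_neg, norm_one]; ring

theorem IsBalanced.isSmallPoint (h : IsBalanced α w) {p : ℤ × ℤ} (hp : IsClassPoint α w p) :
    IsSmallPoint (frameAbs α w) (formAbs α w p) := by
  refine ⟨fun i => mul_pos (h.pos i) (hp.norm_pos i), ?_, hp.min, fun i j k hT => ?_⟩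
  · have h1 := hp.prod
    have h2 := h.prod
    simp only [Fin.prod_univ_four] at h1
    simp only [formAbs]
    calc _ = (w 0 * (w 1 * w 2 * w 3)) * (‖(p.1 : ℂ) - α 0 * p.2‖ * ‖(p.1 : ℂ) - α 1 * p.2‖ *
          ‖(p.1 : ℂ) - α 2 * p.2‖ * ‖(p.1 : ℂ) - α 3 * p.2‖) := by ring
      _ = 1 := by rw [h1, h2, mul_one]
  · have e : ((p.1 : ℂ) - α i * p.2) * (α 0 - α j) = (p.1 - α j * p.2) * (α 0 - α i) +
      (p.1 - α 0 * p.2) * (α i - α j) := by ring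
    have h0 := (h.pos 0).le
    have hi := (h.pos i).le
    have hj := (h.pos j).le
    have hk : frameAbs α w k = _ := h.eq i j k hT
    rw [hk]
    calc _ = w 0 * w i * w j * ‖((p.1 : ℂ) - α i * p.2) * (α 0 - α j)‖ := by
          simp only [formAbs, frameAbs, norm_mul]; ring
      _ ≤ w 0 * w i * w j * (‖((p.1 : ℂ) - α j * p.2) * (α 0 - α i)‖ +
            ‖((p.1 : ℂ) - α 0 * p.2) * (α i - α j)‖) := by
          rw [e]; gcongr; exact norm_add_le _ _
      _ = _ := by simp only [formAbs, frameAbs, norm_mul]; ring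

theorem IsBalanced.frame_det_le (h : IsBalanced α w) (p q : ℤ × ℤ) (i : Fin 4) :
    |((p.1 * q.2 - p.2 * q.1 : ℤ) : ℝ)| * frameAbs α w i ≤
      formAbs α w p 0 * formAbs α w q i + formAbs α w q 0 * formAbs α w p i :=
  h.det_le p q 0 i

/-- The unit of `ℂ⁴` given by the values of the linear forms at a solution. -/
noncomputable def IsClassPoint.unit {p : ℤ × ℤ} (h : IsClassPoint α w p) : (Fin 4 → ℂ)ˣ :=
  MulEquiv.piUnits.symm fun i => Units.mk0 ((p.1 : ℂ) - α i * p.2) (norm_pos_iff.1 (h.norm_pos i))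

theorem IsClassPoint.unit_apply {p : ℤ × ℤ} (h : IsClassPoint α w p) (i : Fin 4) :
    h.unit.val i = (p.1 : ℂ) - α i * p.2 := rfl

theorem IsClassPoint.quot_apply {p q : ℤ × ℤ} (hp : IsClassPoint α w p)
    (hq : IsClassPoint α w q) (i : Fin 4) :
    (hq.unit / hp.unit).val i = ((q.1 : ℂ) - α i * q.2) / ((p.1 : ℂ) - α i * p.2) := by
  rw [div_eq_mul_inv, div_eq_mul_inv, ← hp.unit_apply, ← hq.unit_apply, Units.val_mul,
    Pi.mul_apply]
  congr 1

theorem IsClassPoint.logNorm_quot (h : IsBalanced α w) {p q : ℤ × ℤ} (hp : IsClassPoint α w p)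
    (hq : IsClassPoint α w q) (i : Fin 4) :
    logNorm (hq.unit / hp.unit) i =
      Real.log (formAbs α w q i) - Real.log (formAbs α w p i) := by
  have := h.pos i
  rw [logNorm, hp.quot_apply hq, norm_div, Real.log_div (hq.norm_pos i).ne' (hp.norm_pos i).ne',
    formAbs, formAbs, Real.log_mul this.ne' (hq.norm_pos i).ne',
    Real.log_mul this.ne' (hp.norm_pos i).ne']
  ring

theorem IsClassPoint.sum_logNorm_quot {p q : ℤ × ℤ} (hp : IsClassPoint α w p)
    (hq : IsClassPoint α w q) : ∑ i, logNorm (hq.unit / hp.unit) i = 0 := by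
  simp only [logNorm]
  rw [← Real.log_prod fun i _ => ?_]
  · simp only [hp.quot_apply hq, norm_div, Finset.prod_div_distrib, hp.prod, hq.prod]
    simp
  · rw [hp.quot_apply hq, norm_div]
    exact (div_pos (hq.norm_pos i) (hp.norm_pos i)).ne'

theorem IsClassPoint.norm_quot_sub_one (h : IsBalanced α w) {p q : ℤ × ℤ}
    (hp : IsClassPoint α w p) (hq : IsClassPoint α w q) {i j k : Fin 4} (hT : IsTriple i j k) :
    ‖(hq.unit / hp.unit).val i / (hq.unit / hp.unit).val j - 1‖ =
      |((p.1 * q.2 - p.2 * q.1 : ℤ) : ℝ)| * frameAbs α w k /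
        (formAbs α w p i * formAbs α w q j) := by
  rw [hp.quot_apply hq, hp.quot_apply hq]
  have h1 := norm_pos_iff.1 (hp.norm_pos i)
  have h2 := norm_pos_iff.1 (hp.norm_pos j)
  have h3 := norm_pos_iff.1 (hq.norm_pos i)
  have h4 := norm_pos_iff.1 (hq.norm_pos j)
  have e : ((q.1 : ℂ) - α i * q.2) / (p.1 - α i * p.2) / ((q.1 - α j * q.2) / (p.1 - α j * p.2)) - 1
      = ((p.1 * q.2 - p.2 * q.1 : ℤ) : ℂ) * (α j - α i) /
        ((p.1 - α i * p.2) * (q.1 - α j * q.2)) := by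
    rw [div_div_div_eq, div_sub_one (mul_ne_zero h1 h4)]
    congr 1
    push_cast
    ring
  have hk : frameAbs α w k = _ := h.eq i j k hT
  have hi := (h.pos i).ne'
  have hj := (h.pos j).ne'
  rw [e, norm_div, norm_mul, norm_mul, Complex.norm_intCast, norm_sub_rev (α j), hk, formAbs,
    formAbs]
  have := (hp.norm_pos i).ne'
  have := (hq.norm_pos j).ne'
  field_simp

theorem IsBalanced.one_lt_log_mul_sqrt (h : IsBalanced α w) {S : Finset ℂ}
    {G : Subgroup (Fin 4 → ℂ)ˣ} (hG : ∀ u ∈ G, (∀ i, ‖u.val i‖ ≤ 2) → ∀ i, u.val i ∈ S)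
    {p q r : ℤ × ℤ} (hp : IsClassPoint α w p) (hq : IsClassPoint α w q) (hr : IsClassPoint α w r)
    (hpG : hp.unit ∈ G) (hqG : hq.unit ∈ G) (hrG : hr.unit ∈ G)
    (hpq : p.1 * q.2 - p.2 * q.1 ≠ 0) (hqr : q.1 * r.2 - q.2 * r.1 ≠ 0)
    (hqp : formAbs α w q 0 ≤ formAbs α w p 0) (hrq : formAbs α w r 0 ≤ formAbs α w q 0)
    {l : ℝ} (hl : 0 < l) (hl1 : l ≤ 1) (hpl : formAbs α w p 0 ≤ l)
    (hlu : ∀ i ≠ 0, l ^ 2 * frameAbs α w i ^ 2 ≤ 242)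
    (hp1 : ∀ i ≠ 0, frameAbs α w i ≤ 11 * (l * formAbs α w p i))
    (hq1 : ∀ i ≠ 0, frameAbs α w i ≤ 11 * (l * formAbs α w q i))
    (hp0 : (frameAbs α w 1 * frameAbs α w 2 * frameAbs α w 3) * formAbs α w p 0 ≤ 1331 * l ^ 3)
    (hΔ : 3000000 ≤ frameAbs α w 1 * frameAbs α w 2 * frameAbs α w 3) :
    1 < 40 * (3 * (S.card : ℝ) ^ 4 + 1) *
      (Real.log (formAbs α w q 0 / formAbs α w r 0) * √(formAbs α w p 0)) := by
  by_contra! hcon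
  have hu := h.isFrame
  have hP := h.isSmallPoint hp
  have hQ := h.isSmallPoint hq
  have hR := h.isSmallPoint hr
  have abs1 : ∀ {z : ℤ}, z ≠ 0 → (1 : ℝ) ≤ |(z : ℝ)| := fun hz => by
    exact_mod_cast Int.one_le_abs hz
  have hn1 := abs1 hpq
  have hn2 := abs1 hqr
  have hd1 := fun i (_ : i ≠ 0) => h.frame_det_le p q i
  have hd2 := fun i (_ : i ≠ 0) => h.frame_det_le q r i
  have c1 := hP.cube_mul_le hu hQ hqp (n := 1) zero_le_one fun i hi =>
    le_trans (by have := hu.pos i hi; gcongr) (hd1 i hi)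
  have c2 := hQ.cube_mul_le hu hR hrq (n := 1) zero_le_one fun i hi =>
    le_trans (by have := hu.pos i hi; gcongr) (hd2 i hi)
  have p0 := hP.pos 0
  have q0 := hQ.pos 0
  have r0 := hR.pos 0
  have p1 := hP.le_one
  have q1 := hQ.le_one
  have ratio : ∀ {i j k}, IsTriple i j k →
      ‖(hq.unit / hp.unit).val i / (hq.unit / hp.unit).val j - 1‖ ≤ √(formAbs α w p 0) := by
    intro i j k hT
    rw [hp.norm_quot_sub_one h hq hT, div_le_iff₀ (mul_pos (hP.pos i) (hQ.pos j))]
    exact hP.det_mul_le_sqrt hu hQ hqp hl hl1 hlu hp1 hp0 hΔ (by positivity) hd1 hT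
  have ratio' : ∀ {i j k}, IsTriple i j k →
      ‖(hr.unit / hq.unit).val i / (hr.unit / hq.unit).val j - 1‖ ≤ √(formAbs α w p 0) := by
    intro i j k hT
    rw [hq.norm_quot_sub_one h hr hT, div_le_iff₀ (mul_pos (hQ.pos i) (hR.pos j))]
    refine (hQ.det_mul_le_sqrt hu hR hrq hl hl1 hlu hq1 ?_ hΔ (by positivity) hd2 hT).trans ?_
    · refine le_trans ?_ hp0
      gcongr
    · have := hQ.pos i
      have := hR.pos j
      gcongr
  have diag : ∀ {u : (Fin 4 → ℂ)ˣ} {e : ℝ}, 0 ≤ e →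
      (∀ i j k, IsTriple i j k → ‖u.val i / u.val j - 1‖ ≤ e) →
      ∀ i ≠ 0, ∀ j ≠ 0, ‖u.val i / u.val j - 1‖ ≤ e := by
    intro u e he hT i hi j hj
    rcases eq_or_ne i j with rfl | hij
    · rw [div_self (units_apply_ne_zero u i)]
      simpa using he
    · obtain ⟨k, hk⟩ := exists_isTriple_of_ne i j hi hj hij
      exact hT i j k hk
  obtain ⟨m, b, hb, hbm, hm, hpow⟩ := exists_zpow_mul_zpow_eq_one hG
    (div_mem hqG hpG) (div_mem hrG hqG) (hp.sum_logNorm_quot hq) (hq.sum_logNorm_quot hr)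
    (diag (Real.sqrt_nonneg _) fun i j k hT => ratio hT)
    (diag (Real.sqrt_nonneg _) fun i j k hT => ratio' hT)
    (ℓ := Real.log (formAbs α w p 0 / formAbs α w q 0))
    (ℓ' := Real.log (formAbs α w q 0 / formAbs α w r 0))
    (by rw [hp.logNorm_quot h hq, Real.log_div p0.ne' q0.ne']; ring)
    (by rw [hq.logNorm_quot h hr, Real.log_div q0.ne' r0.ne']; ring)
    (by
      rw [Real.le_log_iff_exp_le (by positivity), le_div_iff₀ q0]
      have e1 : formAbs α w p 0 ^ 3 ≤ formAbs α w p 0 :=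
        pow_le_of_le_one p0.le p1 (by norm_num)
      have e2 := Real.exp_one_lt_d9
      nlinarith)
    (by
      refine Real.log_le_log (by positivity) ?_
      rw [div_le_div_iff₀ q0 r0]
      set D := frameAbs α w 1 * frameAbs α w 2 * frameAbs α w 3
      have e1 : formAbs α w p 0 * formAbs α w q 0 ≤ 1 := by nlinarith
      have e3 : D * (formAbs α w p 0 * formAbs α w r 0) ≤
          D * (formAbs α w q 0 * formAbs α w q 0) :=
        calc D * (formAbs α w p 0 * formAbs α w r 0)
            = formAbs α w p 0 * (1 ^ 3 * D * formAbs α w r 0) := by ring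
          _ ≤ formAbs α w p 0 * (1331 * formAbs α w q 0 ^ 3) := by gcongr
          _ = 1331 * (formAbs α w p 0 * formAbs α w q 0) *
                (formAbs α w q 0 * formAbs α w q 0) := by ring
          _ ≤ 1331 * 1 * (formAbs α w q 0 * formAbs α w q 0) := by gcongr
          _ ≤ _ := by gcongr; linarith
      exact le_of_mul_le_mul_left e3 (by linarith))
    hcon
  have key := norm_div_sub_one_le_of_pow_eq_pow hb hbm hm hpow
    (ratio (i := 1) (j := 2) (k := 3) (by decide)) (ratio' (i := 1) (j := 2) (k := 3) (by decide))
  rw [hp.norm_quot_sub_one h hq (i := 1) (j := 2) (k := 3) (by decide),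
    hq.norm_quot_sub_one h hr (i := 1) (j := 2) (k := 3) (by decide)] at key
  exact hP.false_of_comparable hu hQ hR hqp hrq hl hpl hlu hp1 hq1 hΔ hn1 hd2 key

theorem formAbs_one_zero (α : Fin 4 → ℂ) (w : Fin 4 → ℝ) (i : Fin 4) :
    formAbs α w (1, 0) i = w i := by
  simp [formAbs]

theorem IsBalanced.abs_cube_mul_le (h : IsBalanced α w) (h1 : IsClassPoint α w (1, 0))
    {p : ℤ × ℤ} (hp : IsClassPoint α w p) (hle : formAbs α w p 0 ≤ w 0)
    (hΔ : 1331 ≤ frameAbs α w 1 * frameAbs α w 2 * frameAbs α w 3) :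
    |(p.2 : ℝ)| ^ 3 * formAbs α w p 0 ≤ w 0 ^ 3 := by
  have key := (h.isSmallPoint h1).cube_mul_le h.isFrame (h.isSmallPoint hp)
    (by rwa [formAbs_one_zero]) (n := |(p.2 : ℝ)|) (abs_nonneg _)
    fun i _ => by simpa using h.frame_det_le (1, 0) p i
  rw [formAbs_one_zero] at key
  have hp0 := ((h.isSmallPoint hp).pos 0).le
  have : 1331 * (|(p.2 : ℝ)| ^ 3 * formAbs α w p 0) ≤ 1331 * w 0 ^ 3 := by
    refine le_trans ?_ key
    calc _ = |(p.2 : ℝ)| ^ 3 * 1331 * formAbs α w p 0 := by ring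
      _ ≤ _ := by gcongr
  linarith

theorem IsBalanced.one_le_mul_abs_cube (h : IsBalanced α w)
    {p : ℤ × ℤ} (hp : IsClassPoint α w p) (hle : formAbs α w p 0 ≤ w 0) (hy : p.2 ≠ 0)
    {A : ℝ} (hA2 : 2 ≤ A) (hα : ∀ i, ‖α i - α 0‖ ≤ A - 2) (hA : 1 ≤ A * w 0) :
    1 ≤ formAbs α w p 0 * (A ^ 4 * |(p.2 : ℝ)| ^ 3) := by
  have hw := h.pos 0
  have hy1 : (1 : ℝ) ≤ |(p.2 : ℝ)| := by exact_mod_cast Int.one_le_abs hy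
  have h0 : ‖(p.1 : ℂ) - α 0 * p.2‖ ≤ 1 := by
    rw [formAbs] at hle
    nlinarith
  have hi : ∀ i, ‖(p.1 : ℂ) - α i * p.2‖ ≤ A * |(p.2 : ℝ)| := fun i =>
    calc ‖(p.1 : ℂ) - α i * p.2‖ = ‖((p.1 : ℂ) - α 0 * p.2) - (α i - α 0) * p.2‖ := by
          congr 1; ring
      _ ≤ ‖(p.1 : ℂ) - α 0 * p.2‖ + ‖(α i - α 0) * p.2‖ := norm_sub_le _ _
      _ = ‖(p.1 : ℂ) - α 0 * p.2‖ + ‖α i - α 0‖ * |(p.2 : ℝ)| := by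
          rw [norm_mul, Complex.norm_intCast]
      _ ≤ 1 + (A - 2) * |(p.2 : ℝ)| := by gcongr; exact hα i
      _ ≤ _ := by linarith
  have hprod := hp.prod
  rw [Fin.prod_univ_four] at hprod
  have hp0 := hp.norm_pos 0
  calc (1 : ℝ) ≤ A * w 0 := hA
    _ = A * w 0 * (‖(p.1 : ℂ) - α 0 * p.2‖ * ‖(p.1 : ℂ) - α 1 * p.2‖ *
          ‖(p.1 : ℂ) - α 2 * p.2‖ * ‖(p.1 : ℂ) - α 3 * p.2‖) := by rw [hprod, mul_one]
    _ ≤ A * w 0 * (‖(p.1 : ℂ) - α 0 * p.2‖ * (A * |(p.2 : ℝ)|) *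
          (A * |(p.2 : ℝ)|) * (A * |(p.2 : ℝ)|)) := by
        gcongr <;> apply hi
    _ = _ := by rw [formAbs]; ring

theorem exists_forall_log_mul_sqrt_lt (C : ℝ) :
    ∃ t₀ > 0, ∀ t, 0 < t → t ≤ t₀ → C * (Real.log (1 / t) * √t) < 1 := by
  have h := (tendsto_log_mul_rpow_nhdsGT_zero (r := 1 / 2) (by norm_num)).const_mul (-C)
  rw [mul_zero] at h
  have h1 := h.eventually_lt_const one_pos
  rw [eventually_nhdsWithin_iff, Metric.eventually_nhds_iff] at h1
  obtain ⟨ε, hε, h1⟩ := h1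
  refine ⟨ε / 2, by positivity, fun t ht ht' => ?_⟩
  have := h1 (y := t) (by rw [Real.dist_eq, sub_zero, abs_of_pos ht]; linarith) ht
  rw [one_div, Real.log_inv, Real.sqrt_eq_rpow]
  linarith

theorem not_exists_seven_points : ∃ Δ₀ : ℝ, ∀ {b c d e : ℤ} {α : Fin 4 → ℂ} {w : Fin 4 → ℝ},
    QuarticRoots b c d e α → IsBalanced α w →
    Δ₀ ≤ frameAbs α w 1 * frameAbs α w 2 * frameAbs α w 3 →
    ∀ p : Fin 7 → ℤ × ℤ, p 0 = (1, 0) → (∀ k, IsClassPoint α w (p k)) →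
    (∀ k l, k ≠ l → (p k).1 * (p l).2 - (p k).2 * (p l).1 ≠ 0) →
    ¬ Antitone fun k => formAbs α w (p k) 0 := by
  obtain ⟨S, hS⟩ := exists_finite_integralTuples
  set K : ℝ := 40 * (3 * (S.card : ℝ) ^ 4 + 1) with hK
  have hK0 : 0 < K := by positivity
  obtain ⟨t₀, ht₀, hlog⟩ := exists_forall_log_mul_sqrt_lt (60007 * K)
  refine ⟨max 3000000 (1331 / t₀), ?_⟩
  intro b c d e α w hα h hΔ p hp0 hp hdet hanti
  obtain ⟨V, hV⟩ := hα.exists_integralTuples h.inj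
  have hmem : ∀ k, (hp k).unit ∈ integralTuples V := fun k =>
    hV _ _ (by rw [norm_prod]; exact (hp k).prod) _ (hp k).unit_apply
  have hΔ1 : 3000000 ≤ frameAbs α w 1 * frameAbs α w 2 * frameAbs α w 3 :=
    (le_max_left _ _).trans hΔ
  have hΔ2 : 1331 ≤ (frameAbs α w 1 * frameAbs α w 2 * frameAbs α w 3) * t₀ := by
    rw [← div_le_iff₀ ht₀]
    exact (le_max_right _ _).trans hΔ
  set Δ := frameAbs α w 1 * frameAbs α w 2 * frameAbs α w 3
  have hu := h.isFrame
  have hX := fun k => h.isSmallPoint (hp k)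
  set l : Fin 7 → ℝ := fun k => formAbs α w (p k) 0 with hl
  have lpos : ∀ k, 0 < l k := fun k => (hX k).pos 0
  have lle : ∀ k, l k ≤ 1 := fun k => (hX k).le_one
  have hl0 : l 0 = w 0 := by simp only [hl]; rw [hp0, formAbs_one_zero]
  have hmono : ∀ {j k}, j ≤ k → l k ≤ l j := fun hjk => hanti hjk
  have hd : ∀ {j k}, j ≠ k → ∀ i ≠ 0, 1 * frameAbs α w i ≤
      l j * formAbs α w (p k) i + l k * formAbs α w (p j) i := by
    intro j k hjk i hi
    refine le_trans ?_ (h.frame_det_le (p j) (p k) i)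
    have := hu.pos i hi
    gcongr
    exact_mod_cast Int.one_le_abs (hdet j k hjk)
  have hlu : ∀ i ≠ 0, l 1 ^ 2 * frameAbs α w i ^ 2 ≤ 242 := fun i hi =>
    (hX 1).sq_mul_sq_le hu (fun i hi => by
      have e := (hX 0).det_mul_le hu (hX 1) (hmono (by decide)) hi (hd (by decide) i hi)
      have := (hX 1).pos i
      have : l 0 * formAbs α w (p 1) i ≤ 1 * formAbs α w (p 1) i := by gcongr; exact lle 0
      change 1 * frameAbs α w i ≤ 11 * (l 0 * formAbs α w (p 1) i) at e
      linarith) hi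
  have hp1 : ∀ k > 1, ∀ i ≠ 0, frameAbs α w i ≤ 11 * (l 1 * formAbs α w (p k) i) :=
    fun k hk i hi => by
      have e := (hX 1).det_mul_le hu (hX k) (hmono hk.le) hi (hd hk.ne i hi)
      rwa [one_mul] at e
  have hl1 : ∀ k > 1, Δ * l k ≤ 1331 * l 1 ^ 3 := fun k hk => by
    have e := (hX 1).cube_mul_le hu (hX k) (hmono hk.le) zero_le_one (hd hk.ne)
    rwa [one_pow, one_mul] at e
  have gap : ∀ i j k : Fin 7, 1 < i → i < j → j < k →
      1 < K * (Real.log (1 / l k) * √(l i)) := by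
    intro i j k hi hij hjk
    refine (h.one_lt_log_mul_sqrt (hS V) (hp i) (hp j) (hp k) (hmem i) (hmem j) (hmem k)
      (hdet _ _ hij.ne) (hdet _ _ hjk.ne) (hmono hij.le) (hmono hjk.le) (lpos 1) (lle 1)
      (hmono hi.le) hlu (hp1 i hi) (hp1 j (hi.trans hij)) (hl1 i hi) hΔ1).trans_le ?_
    have := lpos k
    have := lpos j
    have := lle j
    change K * (Real.log (l j / l k) * √(l i)) ≤ _
    gcongr
  have ht : ∀ k > 1, l k ≤ t₀ := fun k hk => by
    have e1 := hl1 k hk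
    have e2 : l 1 ^ 3 ≤ 1 := pow_le_one₀ (lpos 1).le (lle 1)
    have e3 : Δ * l k ≤ Δ * t₀ := by linarith
    exact le_of_mul_le_mul_left e3 (by linarith)
  have step : ∀ i j k : Fin 7, 1 < i → i < j → j < k →
      60007 * Real.log (1 / l i) < Real.log (1 / l k) := by
    intro i j k hi hij hjk
    have e1 := hlog (l i) (lpos i) (ht i hi)
    have e2 := gap i j k hi hij hjk
    have hs : 0 < √(l i) := Real.sqrt_pos.2 (lpos i)
    have e3 : (K * √(l i)) * (60007 * Real.log (1 / l i)) < (K * √(l i)) * Real.log (1 / l k) := by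
      linarith
    exact lt_of_mul_lt_mul_left e3 (by positivity)
  have s1 := step 2 3 4 (by decide) (by decide) (by decide)
  have s2 := step 4 5 6 (by decide) (by decide) (by decide)
  obtain ⟨A, hA⟩ : ∃ A, A = 1 / l 2 := ⟨_, rfl⟩
  have hAl : A * l 2 = 1 := by rw [hA]; field_simp [(lpos 2).ne']
  have hA16 : 18 ≤ A * l 1 ^ 3 := by
    have e1 := hl1 2 (by decide)
    have e2 : (1331 * 18) * l 2 ≤ 1331 * l 1 ^ 3 := by
      have := lpos 2
      nlinarith
    have e3 : 18 * l 2 ≤ (A * l 1 ^ 3) * l 2 := by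
      calc 18 * l 2 ≤ l 1 ^ 3 := by linarith
        _ = l 1 ^ 3 * (A * l 2) := by rw [hAl, mul_one]
        _ = _ := by ring
    exact le_of_mul_le_mul_right e3 (lpos 2)
  have hA18 : 18 ≤ A := by
    have e2 : l 1 ^ 3 ≤ 1 := pow_le_one₀ (lpos 1).le (lle 1)
    have : 0 < A := by rw [hA]; exact one_div_pos.2 (lpos 2)
    nlinarith
  have hαA : ∀ i, ‖α i - α 0‖ ≤ A - 2 := by
    intro i
    rcases eq_or_ne i 0 with rfl | hi
    · rw [sub_self, norm_zero]; linarith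
    have e1 : l 1 * frameAbs α w i ≤ 16 := by
      have := hlu i hi
      refine (abs_le_of_sq_le_sq' ?_ (by norm_num)).2
      linarith [mul_pow (l 1) (frameAbs α w i) 2]
    have e2 : l 0 ≤ w i := by
      have := (hp 0).min i
      rw [hp0, formAbs_one_zero, formAbs_one_zero] at this
      rwa [hl0]
    have e3 : l 1 ≤ l 0 := hmono (by decide)
    have l1 := lpos 1
    have e4 : l 1 ^ 3 * ‖α i - α 0‖ ≤ l 1 ^ 3 * (A - 2) :=
      calc l 1 ^ 3 * ‖α i - α 0‖ = l 1 * (l 1 * l 1 * ‖α i - α 0‖) := by ring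
        _ ≤ l 1 * (l 0 * w i * ‖α i - α 0‖) := by
            have := lpos 0
            gcongr
            exact e3.trans e2
        _ = l 1 * frameAbs α w i := by rw [frameAbs, hl0, norm_sub_rev]
        _ ≤ 16 := e1
        _ ≤ _ := by
            have e2 : l 1 ^ 3 ≤ 1 := pow_le_one₀ (lpos 1).le (lle 1)
            linarith
    exact le_of_mul_le_mul_left e4 (by positivity)
  have hAw : 1 ≤ A * w 0 := by
    rw [← hAl, ← hl0]
    have : l 2 ≤ l 0 := hmono (by decide)
    gcongr
  have hy : ∀ k > 0, (p k).2 ≠ 0 := fun k hk h0 => by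
    have := hdet 0 k hk.ne
    rw [hp0, h0] at this
    simp at this
  have hup : ∀ k > 0, |((p k).2 : ℝ)| ^ 3 * l k ≤ w 0 ^ 3 := fun k hk =>
    h.abs_cube_mul_le (hp0 ▸ hp 0) (hp k) (hl0 ▸ hmono hk.le) (by linarith)
  have hlow : ∀ k > 0, 1 ≤ l k * (A ^ 4 * |((p k).2 : ℝ)| ^ 3) := fun k hk =>
    h.one_le_mul_abs_cube (hp k) (hl0 ▸ hmono hk.le) (hy k hk) (by linarith) hαA hAw
  have hy1 : ∀ k > 0, (1 : ℝ) ≤ |((p k).2 : ℝ)| := fun k hk => by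
    exact_mod_cast Int.one_le_abs (hy k hk)
  have hlowlog : ∀ k > 0, Real.log (1 / l k) ≤ 4 * Real.log A + 3 * Real.log |((p k).2 : ℝ)| := by
    intro k hk
    have hyk := hy1 k hk
    have e1 : 1 / l k ≤ A ^ 4 * |((p k).2 : ℝ)| ^ 3 := by
      rw [div_le_iff₀ (lpos k)]
      linarith [hlow k hk]
    have e2 := Real.log_le_log (one_div_pos.2 (lpos k)) e1
    rwa [Real.log_mul (by positivity) (by positivity), Real.log_pow, Real.log_pow] at e2
  have hw0 : 0 < w 0 := h.pos 0
  have hw1 : w 0 ≤ 1 := hl0 ▸ lle 0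
  have huplog : ∀ k > 0, 3 * Real.log |((p k).2 : ℝ)| ≤ Real.log (1 / l k) := by
    intro k hk
    have hyk := hy1 k hk
    have e1 : |((p k).2 : ℝ)| ^ 3 ≤ 1 / l k := by
      rw [le_div_iff₀ (lpos k)]
      exact (hup k hk).trans (pow_le_one₀ hw0.le hw1)
    have e2 := Real.log_le_log (by positivity) e1
    rwa [Real.log_pow] at e2
  have happ : ∀ k > 0, ‖α 0 - (p k).1 / (p k).2‖ ^ 2 * |((p k).2 : ℝ)| ^ 7 ≤ 1 := by
    intro k hk
    have hyk := hy1 k hk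
    have hyc : ((p k).2 : ℂ) ≠ 0 := by exact_mod_cast hy k hk
    have e1 : ‖α 0 - (p k).1 / (p k).2‖ * (|((p k).2 : ℝ)| * w 0) = l k := by
      have : (p k).1 - α 0 * (p k).2 = -(α 0 - (p k).1 / (p k).2) * ((p k).2 : ℂ) := by
        field_simp
        ring
      simp only [hl, formAbs]
      rw [this, norm_mul, norm_neg, Complex.norm_intCast]
      ring
    set n := ‖α 0 - (p k).1 / (p k).2‖
    set y := |((p k).2 : ℝ)|
    have e2 : n * y ^ 4 ≤ w 0 ^ 2 := by
      have := hup k hk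
      rw [← e1] at this
      have : w 0 * (n * y ^ 4) ≤ w 0 * w 0 ^ 2 := by
        calc _ = y ^ 3 * (n * (y * w 0)) := by ring
          _ ≤ _ := this
          _ = _ := by ring
      exact le_of_mul_le_mul_left this hw0
    have hn0 : 0 ≤ n := norm_nonneg _
    calc n ^ 2 * y ^ 7 ≤ n ^ 2 * y ^ 8 := by gcongr; norm_num
      _ = (n * y ^ 4) ^ 2 := by ring
      _ ≤ (w 0 ^ 2) ^ 2 := by gcongr
      _ ≤ 1 := pow_le_one₀ (by positivity) (pow_le_one₀ hw0.le hw1)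
  have hlogA : Real.log (1 / l 2) = Real.log A := by rw [hA]
  rw [hlogA] at s1
  have hApos : 0 < Real.log A := Real.log_pos (by linarith)
  have g1 := hlowlog 4 (by decide)
  have hlarge : A ^ 20001 ≤ |((p 4).2 : ℝ)| := by
    have hy4 := hy1 4 (by decide)
    have hAp : 0 < A := by linarith
    rw [← Real.log_le_log_iff (pow_pos hAp _) (by linarith), Real.log_pow]
    push_cast
    linarith
  have hfin := hα.abs_le_pow_of_approx h.inj (by linarith) hαA (hy 4 (by decide)) (hy 6 (by decide))
    (fun i hi => by
      have hyc : ((p 4).2 : ℂ) ≠ 0 := by exact_mod_cast hy 4 (by decide)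
      have := norm_pos_iff.1 ((hp 4).norm_pos i)
      rw [div_eq_iff hyc] at hi
      exact this (by rw [hi, sub_self])) (happ 4 (by decide)) (happ 6 (by decide)) hlarge
  have g2 := Real.log_le_log (by linarith [hy1 6 (by decide)]) hfin
  rw [Real.log_pow] at g2
  push_cast at g2
  have g3 := hlowlog 6 (by decide)
  have g4 := huplog 4 (by decide)
  linarith

end

theorem exists_root_of_quartic (a b c d e : ℂ) (h : a ≠ 0 ∨ b ≠ 0 ∨ c ≠ 0 ∨ d ≠ 0) :
    ∃ z : ℂ, a * z ^ 4 + b * z ^ 3 + c * z ^ 2 + d * z + e = 0 := by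
  set p : Polynomial ℂ := .C a * .X ^ 4 + .C b * .X ^ 3 + .C c * .X ^ 2 + .C d * .X + .C e with hp
  obtain ⟨z, hz⟩ := IsAlgClosed.exists_root p fun h0 => by
    have h1 := Polynomial.eq_C_of_degree_eq_zero h0
    have h2 : ∀ n ≠ 0, p.coeff n = 0 := fun n hn => by
      rw [h1, Polynomial.coeff_C_of_ne_zero hn]
    have e4 := h2 4 (by norm_num)
    have e3 := h2 3 (by norm_num)
    have e2 := h2 2 (by norm_num)
    have e1 := h2 1 (by norm_num)
    simp [hp, Polynomial.coeff_C] at e1 e2 e3 e4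
    tauto
  exact ⟨z, by simpa [hp, Polynomial.IsRoot] using hz⟩

theorem exists_factorization_of_cubic {a : ℂ} (ha : a ≠ 0) (b c d : ℂ) :
    ∃ α β γ : ℂ, b = -a * (α + β + γ) ∧ c = a * (α * β + α * γ + β * γ) ∧
      d = -a * (α * β * γ) := by
  obtain ⟨α, hα⟩ := exists_root_of_quartic 0 a b c d (by tauto)
  obtain ⟨β, hβ⟩ := exists_root_of_quartic 0 0 a (b + a * α) (c + (b + a * α) * α) (by tauto)
  obtain ⟨γ, hγ⟩ := exists_root_of_quartic 0 0 0 a (b + a * α + a * β) (by tauto)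
  refine ⟨α, β, γ, by linear_combination hγ, ?_, ?_⟩
  · linear_combination hβ - (α + β) * hγ
  · linear_combination hα - α * hβ + α * β * hγ

/-- Over `ℂ` a binary quartic form of nonzero discriminant splits into linear forms, and its
discriminant is the product of the squares of their determinants. -/
theorem exists_linear_factorization (a b c d e : ℤ) (hD : quarticDisc a b c d e ≠ 0) :
    ∃ A B : Fin 4 → ℂ, (∀ x y : ℂ, a * x ^ 4 + b * x ^ 3 * y + c * x ^ 2 * y ^ 2 +
      d * x * y ^ 3 + e * y ^ 4 = ∏ i, (A i * x + B i * y)) ∧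
      (quarticDisc a b c d e : ℂ) = ((A 0 * B 1 - A 1 * B 0) * (A 0 * B 2 - A 2 * B 0) *
        (A 0 * B 3 - A 3 * B 0) * (A 1 * B 2 - A 2 * B 1) * (A 1 * B 3 - A 3 * B 1) *
        (A 2 * B 3 - A 3 * B 2)) ^ 2 := by
  by_cases ha : a = 0
  · have hb : (b : ℂ) ≠ 0 := by
      rintro hb
      rw [Int.cast_eq_zero] at hb
      apply hD
      rw [ha, hb, quarticDisc]
      ring
    obtain ⟨α, β, γ, h1, h2, h3⟩ := exists_factorization_of_cubic hb (c : ℂ) d e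
    refine ⟨![0, b, 1, 1], ![1, -b * α, -β, -γ], fun x y => ?_, ?_⟩
    · simp only [Fin.prod_univ_four, Matrix.cons_val]
      rw [ha, h1, h2, h3]
      push_cast
      ring
    · simp only [Matrix.cons_val, quarticDisc]
      push_cast
      rw [ha, h1, h2, h3]
      push_cast
      ring
  · have ha' : (a : ℂ) ≠ 0 := by exact_mod_cast ha
    obtain ⟨z, hz⟩ := exists_root_of_quartic a b c d e (by tauto)
    obtain ⟨α, β, γ, h1, h2, h3⟩ := exists_factorization_of_cubic ha' (b + a * z)
      (c + (b + a * z) * z) (d + (c + (b + a * z) * z) * z)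
    have hb : (b : ℂ) = -a * (z + α + β + γ) := by linear_combination h1
    have hc : (c : ℂ) = a * (z * (α + β + γ) + (α * β + α * γ + β * γ)) := by
      linear_combination h2 - z * h1
    have hd : (d : ℂ) = -a * (z * (α * β + α * γ + β * γ) + α * β * γ) := by
      linear_combination h3 - z * h2
    have he : (e : ℂ) = a * (z * (α * β * γ)) := by
      linear_combination hz - z * h3
    refine ⟨![a, 1, 1, 1], ![-a * z, -α, -β, -γ], fun x y => ?_, ?_⟩
    · simp only [Fin.prod_univ_four, Matrix.cons_val]
      rw [hb, hc, hd, he]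
      ring
    · simp only [Matrix.cons_val, quarticDisc]
      push_cast
      rw [hb, hc, hd, he]
      ring

/-- A factorization of a binary quartic form into linear forms `A i * x + B i * y` such that
complementary determinants of the linear forms have equal absolute values. -/
structure IsBalancedFactorization (a b c d e : ℤ) (A B : Fin 4 → ℂ) : Prop where
  eval : ∀ x y : ℂ, a * x ^ 4 + b * x ^ 3 * y + c * x ^ 2 * y ^ 2 + d * x * y ^ 3 + e * y ^ 4 =
    ∏ i, (A i * x + B i * y)
  ne : ∀ i j, i ≠ j → A i * B j - A j * B i ≠ 0
  eq : ∀ i j k l, [i, j, k, l].Nodup → ‖A i * B j - A j * B i‖ = ‖A k * B l - A l * B k‖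
  disc : ∀ i j k l, [i, j, k, l].Nodup →
    (‖A i * B j - A j * B i‖ * ‖A i * B k - A k * B i‖ * ‖A i * B l - A l * B i‖) ^ 4 =
      |(quarticDisc a b c d e : ℝ)|

theorem IsBalancedFactorization.comp_perm {a b c d e : ℤ} {A B : Fin 4 → ℂ}
    (h : IsBalancedFactorization a b c d e A B) (σ : Equiv.Perm (Fin 4)) :
    IsBalancedFactorization a b c d e (A ∘ σ) (B ∘ σ) := by
  have hσ : ∀ {i j k l}, [i, j, k, l].Nodup → [σ i, σ j, σ k, σ l].Nodup := fun hn =>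
    List.Nodup.map σ.injective hn
  refine ⟨fun x y => ?_, fun i j hij => h.ne _ _ (σ.injective.ne hij),
    fun i j k l hn => h.eq _ _ _ _ (hσ hn), fun i j k l hn => h.disc _ _ _ _ (hσ hn)⟩
  rw [h.eval]
  exact (Equiv.prod_comp σ fun i => A i * x + B i * y).symm

theorem exists_balancing_weights {g : Fin 4 → Fin 4 → ℝ} (hg : ∀ i j, i ≠ j → 0 < g i j)
    (hsymm : ∀ i j, g i j = g j i) :
    ∃ w : Fin 4 → ℝ, (∀ i, 0 < w i) ∧ ∏ i, w i = 1 ∧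
      (∀ i j k l, [i, j, k, l].Nodup → w i * w j * g i j = w k * w l * g k l) ∧
      ∀ i j k l, [i, j, k, l].Nodup →
        ((w i * w j * g i j) * (w i * w k * g i k) * (w i * w l * g i l)) ^ 4 =
          (g 0 1 * g 0 2 * g 0 3 * g 1 2 * g 1 3 * g 2 3) ^ 2 := by
  have hroot : ∀ i j, ∃ r : ℝ, 0 < r ∧ (i ≠ j → g i j = r ^ 4) := fun i j => by
    by_cases hij : i = j
    · exact ⟨1, one_pos, fun h => absurd hij h⟩
    · refine ⟨√√(g i j), Real.sqrt_pos.2 (Real.sqrt_pos.2 (hg i j hij)), fun _ => ?_⟩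
      rw [show 4 = 2 * 2 from rfl, pow_mul, Real.sq_sqrt (Real.sqrt_nonneg _),
        Real.sq_sqrt (hg i j hij).le]
  choose r hr0 hr using hroot
  have p01 := hr0 0 1
  have p02 := hr0 0 2
  have p03 := hr0 0 3
  have p12 := hr0 1 2
  have p13 := hr0 1 3
  have p23 := hr0 2 3
  obtain ⟨w, hw⟩ : ∃ w : Fin 4 → ℝ, w = ![r 1 2 * r 1 3 * r 2 3 / (r 0 1 * r 0 2 * r 0 3),
    r 0 2 * r 0 3 * r 2 3 / (r 0 1 * r 1 2 * r 1 3),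
    r 0 1 * r 0 3 * r 1 3 / (r 0 2 * r 1 2 * r 2 3),
    r 0 1 * r 0 2 * r 1 2 / (r 0 3 * r 1 3 * r 2 3)] := ⟨_, rfl⟩
  have w0 : w 0 = r 1 2 * r 1 3 * r 2 3 / (r 0 1 * r 0 2 * r 0 3) := by rw [hw]; rfl
  have w1 : w 1 = r 0 2 * r 0 3 * r 2 3 / (r 0 1 * r 1 2 * r 1 3) := by rw [hw]; rfl
  have w2 : w 2 = r 0 1 * r 0 3 * r 1 3 / (r 0 2 * r 1 2 * r 2 3) := by rw [hw]; rfl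
  have w3 : w 3 = r 0 1 * r 0 2 * r 1 2 / (r 0 3 * r 1 3 * r 2 3) := by rw [hw]; rfl
  have g01 : g 0 1 = r 0 1 ^ 4 := hr 0 1 (by decide)
  have g02 : g 0 2 = r 0 2 ^ 4 := hr 0 2 (by decide)
  have g03 : g 0 3 = r 0 3 ^ 4 := hr 0 3 (by decide)
  have g12 : g 1 2 = r 1 2 ^ 4 := hr 1 2 (by decide)
  have g13 : g 1 3 = r 1 3 ^ 4 := hr 1 3 (by decide)
  have g23 : g 2 3 = r 2 3 ^ 4 := hr 2 3 (by decide)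
  have d01 : w 0 * w 1 * g 0 1 = (r 0 1 * r 2 3) ^ 2 := by rw [w0, w1, g01]; field_simp
  have d02 : w 0 * w 2 * g 0 2 = (r 0 2 * r 1 3) ^ 2 := by rw [w0, w2, g02]; field_simp
  have d03 : w 0 * w 3 * g 0 3 = (r 0 3 * r 1 2) ^ 2 := by rw [w0, w3, g03]; field_simp
  have d12 : w 1 * w 2 * g 1 2 = (r 0 3 * r 1 2) ^ 2 := by rw [w1, w2, g12]; field_simp
  have d13 : w 1 * w 3 * g 1 3 = (r 0 2 * r 1 3) ^ 2 := by rw [w1, w3, g13]; field_simp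
  have d23 : w 2 * w 3 * g 2 3 = (r 0 1 * r 2 3) ^ 2 := by rw [w2, w3, g23]; field_simp
  have d10 : w 1 * w 0 * g 1 0 = (r 0 1 * r 2 3) ^ 2 := by rw [hsymm, mul_comm (w 1), d01]
  have d20 : w 2 * w 0 * g 2 0 = (r 0 2 * r 1 3) ^ 2 := by rw [hsymm, mul_comm (w 2), d02]
  have d30 : w 3 * w 0 * g 3 0 = (r 0 3 * r 1 2) ^ 2 := by rw [hsymm, mul_comm (w 3), d03]
  have d21 : w 2 * w 1 * g 2 1 = (r 0 3 * r 1 2) ^ 2 := by rw [hsymm, mul_comm (w 2), d12]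
  have d31 : w 3 * w 1 * g 3 1 = (r 0 2 * r 1 3) ^ 2 := by rw [hsymm, mul_comm (w 3), d13]
  have d32 : w 3 * w 2 * g 3 2 = (r 0 1 * r 2 3) ^ 2 := by rw [hsymm, mul_comm (w 3), d23]
  refine ⟨w, fun i => ?_, ?_, ?_, ?_⟩
  · fin_cases i
    · change 0 < w 0; rw [w0]; positivity
    · change 0 < w 1; rw [w1]; positivity
    · change 0 < w 2; rw [w2]; positivity
    · change 0 < w 3; rw [w3]; positivity
  · rw [Fin.prod_univ_four, w0, w1, w2, w3]; field_simp
  · simp only [Fin.forall_fin_succ, Fin.forall_fin_zero, Fin.succ_zero_eq_one,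
      Fin.succ_one_eq_two, Fin.isValue]
    simp [d01, d02, d03, d12, d13, d23, d10, d20, d30, d21, d31, d32]
  · rw [g01, g02, g03, g12, g13, g23]
    intro i j k l
    fin_cases i <;> fin_cases j <;> fin_cases k <;> fin_cases l <;>
      first
      | (intro h; exact absurd h (by decide))
      | (intro _; simp [d01, d02, d03, d12, d13, d23, d10, d20, d30, d21, d31, d32]; ring)

theorem exists_isBalancedFactorization (a b c d e : ℤ) (hD : quarticDisc a b c d e ≠ 0) :
    ∃ A B : Fin 4 → ℂ, IsBalancedFactorization a b c d e A B := by
  obtain ⟨A, B, heval, hdisc⟩ := exists_linear_factorization a b c d e hD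
  have hne' : ∀ i j : Fin 4, i < j → A i * B j - A j * B i ≠ 0 := by
    have hD' : (quarticDisc a b c d e : ℂ) ≠ 0 := by exact_mod_cast hD
    rw [hdisc] at hD'
    simp only [ne_eq, pow_eq_zero_iff (two_ne_zero), mul_eq_zero, not_or] at hD'
    obtain ⟨⟨⟨⟨⟨h1, h2⟩, h3⟩, h4⟩, h5⟩, h6⟩ := hD'
    intro i j hij
    fin_cases i <;> fin_cases j <;> first | assumption | exact absurd hij (by decide)
  have hne : ∀ i j : Fin 4, i ≠ j → A i * B j - A j * B i ≠ 0 := by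
    intro i j hij
    rcases hij.lt_or_gt with h | h
    · exact hne' i j h
    · rw [← neg_sub]
      exact neg_ne_zero.2 (hne' j i h)
  obtain ⟨w, hw0, hw1, hw2, hw3⟩ := exists_balancing_weights
    (g := fun i j => ‖A i * B j - A j * B i‖) (fun i j hij => norm_pos_iff.2 (hne i j hij))
    (fun i j => norm_sub_rev _ _)
  have hdet : ∀ i j, (w i * A i : ℂ) * (w j * B j) - w j * A j * (w i * B i) =
      w i * w j * (A i * B j - A j * B i) := fun i j => by ring
  have hnorm : ∀ i j, ‖(w i * A i : ℂ) * (w j * B j) - w j * A j * (w i * B i)‖ =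
      w i * w j * ‖A i * B j - A j * B i‖ := fun i j => by
    rw [hdet, norm_mul, norm_mul, Complex.norm_of_nonneg (hw0 i).le,
      Complex.norm_of_nonneg (hw0 j).le]
  refine ⟨fun i => w i * A i, fun i => w i * B i, fun x y => ?_, fun i j hij => ?_,
    fun i j k l hn => ?_, fun i j k l hn => ?_⟩
  · rw [heval]
    have : ∏ i, (w i : ℂ) = 1 := by exact_mod_cast hw1
    rw [← one_mul (∏ i, (A i * x + B i * y)), ← this, ← Finset.prod_mul_distrib]
    exact Finset.prod_congr rfl fun i _ => by ring
  · rw [hdet]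
    have hi : (w i : ℂ) ≠ 0 := by exact_mod_cast (hw0 i).ne'
    have hj : (w j : ℂ) ≠ 0 := by exact_mod_cast (hw0 j).ne'
    exact mul_ne_zero (mul_ne_zero hi hj) (hne i j hij)
  · simp only [hnorm]
    exact hw2 i j k l hn
  · simp only [hnorm]
    rw [hw3 i j k l hn]
    have : |(quarticDisc a b c d e : ℝ)| = ‖(quarticDisc a b c d e : ℂ)‖ := by
      rw [Complex.norm_intCast]
    rw [this, hdisc, norm_pow]
    simp only [norm_mul]

theorem eq_of_forall_quartic_eq {a b c d e a' b' c' d' e' : ℂ}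
    (h : ∀ x y : ℂ, a * x ^ 4 + b * x ^ 3 * y + c * x ^ 2 * y ^ 2 + d * x * y ^ 3 + e * y ^ 4 =
      a' * x ^ 4 + b' * x ^ 3 * y + c' * x ^ 2 * y ^ 2 + d' * x * y ^ 3 + e' * y ^ 4) :
    a = a' ∧ b = b' ∧ c = c' ∧ d = d' ∧ e = e' := by
  have h1 := h 1 0
  have h2 := h 0 1
  have h3 := h 1 1
  have h4 := h 1 (-1)
  have h5 := h 1 2
  refine ⟨by linear_combination h1, ?_, ?_, ?_, by linear_combination h2⟩
  · linear_combination -1 / 2 * h1 + 2 * h2 + h3 - 1 / 3 * h4 - 1 / 6 * h5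
  · linear_combination -1 * h1 - h2 + 1 / 2 * h3 + 1 / 2 * h4
  · linear_combination 1 / 2 * h1 - 2 * h2 - 1 / 2 * h3 - 1 / 6 * h4 + 1 / 6 * h5

theorem exists_quartic_comp (a b c d e x s y t : ℤ) :
    ∃ a' b' c' d' e' : ℤ, ∀ u v : ℂ, a * (x * u + s * v) ^ 4 +
      b * (x * u + s * v) ^ 3 * (y * u + t * v) + c * (x * u + s * v) ^ 2 * (y * u + t * v) ^ 2 +
      d * (x * u + s * v) * (y * u + t * v) ^ 3 + e * (y * u + t * v) ^ 4 =
      a' * u ^ 4 + b' * u ^ 3 * v + c' * u ^ 2 * v ^ 2 + d' * u * v ^ 3 + e' * v ^ 4 := by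
  refine ⟨a * x ^ 4 + b * x ^ 3 * y + c * x ^ 2 * y ^ 2 + d * x * y ^ 3 + e * y ^ 4,
    4 * a * x ^ 3 * s + b * (3 * x ^ 2 * s * y + x ^ 3 * t) +
      c * (2 * x * s * y ^ 2 + 2 * x ^ 2 * y * t) + d * (s * y ^ 3 + 3 * x * y ^ 2 * t) +
      4 * e * y ^ 3 * t,
    6 * a * x ^ 2 * s ^ 2 + b * (3 * x * s ^ 2 * y + 3 * x ^ 2 * s * t) +
      c * (s ^ 2 * y ^ 2 + 4 * x * s * y * t + x ^ 2 * t ^ 2) +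
      d * (3 * s * y ^ 2 * t + 3 * x * y * t ^ 2) + 6 * e * y ^ 2 * t ^ 2,
    4 * a * x * s ^ 3 + b * (s ^ 3 * y + 3 * x * s ^ 2 * t) +
      c * (2 * s ^ 2 * y * t + 2 * x * s * t ^ 2) + d * (3 * s * y * t ^ 2 + x * t ^ 3) +
      4 * e * y * t ^ 3,
    a * s ^ 4 + b * s ^ 3 * t + c * s ^ 2 * t ^ 2 + d * s * t ^ 3 + e * t ^ 4, fun u v => ?_⟩
  push_cast
  ring

theorem prod_linear_eq_one_of_sol {a b c d e : ℤ} {A B : Fin 4 → ℂ}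
    (h : IsBalancedFactorization a b c d e A B) (p : QuarticThueSol a b c d e) :
    ∏ i, ‖A i * p.1.1 + B i * p.1.2‖ = 1 := by
  rw [← norm_prod, ← h.eval]
  have : ‖(quarticFormVal a b c d e p.1 : ℂ)‖ = 1 := by
    rcases p.2 with h | h <;> rw [h] <;> simp
  rw [quarticFormVal] at this
  push_cast at this
  exact this

theorem QuarticThueSol.isCoprime {a b c d e : ℤ} (p : QuarticThueSol a b c d e) :
    IsCoprime p.1.1 p.1.2 := by
  obtain ⟨⟨x, y⟩, h⟩ := p
  simp only [quarticFormVal] at h ⊢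
  rcases h with h | h
  · exact ⟨a * x ^ 3 + b * x ^ 2 * y + c * x * y ^ 2 + d * y ^ 3, e * y ^ 3,
      by linear_combination h⟩
  · exact ⟨-(a * x ^ 3 + b * x ^ 2 * y + c * x * y ^ 2 + d * y ^ 3), -(e * y ^ 3),
      by linear_combination -h⟩

theorem QuarticThueSol.pmRel_of_det_eq_zero {a b c d e : ℤ} (p q : QuarticThueSol a b c d e)
    (h : p.1.1 * q.1.2 - p.1.2 * q.1.1 = 0) : pmRelQuartic a b c d e p q := by
  obtain ⟨r, s, hrs⟩ := q.isCoprime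
  obtain ⟨u, v, huv⟩ := p.isCoprime
  obtain ⟨⟨x, y⟩, hp⟩ := p
  obtain ⟨⟨x', y'⟩, hq⟩ := q
  simp only at h hrs huv
  set g := r * x + s * y with hg
  have h1 : x = g * x' := by rw [hg]; linear_combination s * h - x * hrs
  have h2 : y = g * y' := by rw [hg]; linear_combination -r * h - y * hrs
  have hunit : IsUnit g := .of_mul_eq_one (u * x' + v * y') (by
    linear_combination huv - u * h1 - v * h2)
  rw [pmRelQuartic]
  rcases Int.isUnit_iff.1 hunit with h0 | h0 <;> rw [h0] at h1 h2
  · left; simp [h1, h2]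
  · right; simp [h1, h2]

/-- The chart in which a given solution becomes `(1, 0)`. -/
theorem IsBalancedFactorization.exists_chart {a b c d e : ℤ} {A B : Fin 4 → ℂ}
    (h : IsBalancedFactorization a b c d e A B) (p₀ : QuarticThueSol a b c d e) :
    ∃ (b' c' d' e' : ℤ) (α : Fin 4 → ℂ) (w : Fin 4 → ℝ) (φ : ℤ × ℤ → ℤ × ℤ),
      QuarticRoots b' c' d' e' α ∧ IsBalanced α w ∧
      (∀ i j, w i * w j * ‖α i - α j‖ = ‖A i * B j - A j * B i‖) ∧
      φ p₀.1 = (1, 0) ∧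
      (∀ p q, (φ p).1 * (φ q).2 - (φ p).2 * (φ q).1 = p.1 * q.2 - p.2 * q.1) ∧
      (∀ p i, formAbs α w (φ p) i = ‖A i * p.1 + B i * p.2‖) ∧
      ∀ p : QuarticThueSol a b c d e, ∏ i, ‖((φ p.1).1 : ℂ) - α i * (φ p.1).2‖ = 1 := by
  obtain ⟨t, s', hst⟩ := p₀.isCoprime
  obtain ⟨s, rfl⟩ : ∃ s, s' = -s := ⟨-s', (neg_neg _).symm⟩
  have hprod := prod_linear_eq_one_of_sol h p₀
  have hval := p₀.2
  set x := p₀.1.1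
  set y := p₀.1.2
  have hL := norm_pos_of_prod_eq_one (β := fun i => A i * x + B i * y) hprod
  have hL0 : ∀ i, A i * x + B i * y ≠ 0 := fun i => norm_pos_iff.1 (hL i)
  have hst' : (t * x + -s * y : ℂ) = 1 := by exact_mod_cast hst
  obtain ⟨α, hα⟩ : ∃ α : Fin 4 → ℂ, ∀ i, (A i * x + B i * y) * α i = -(A i * s + B i * t) :=
    ⟨fun i => -(A i * s + B i * t) / (A i * x + B i * y), fun i => by
      field_simp [hL0 i]⟩
  have hlin : ∀ i (u v : ℂ), A i * (x * u + s * v) + B i * (y * u + t * v) =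
      (A i * x + B i * y) * (u - α i * v) := fun i u v => by
    linear_combination v * hα i
  have hform : ∀ (p : ℤ × ℤ) i, ‖A i * x + B i * y‖ *
      ‖((t * p.1 - s * p.2 : ℤ) : ℂ) - α i * ((x * p.2 - y * p.1 : ℤ) : ℂ)‖ =
        ‖A i * p.1 + B i * p.2‖ := fun p i => by
    rw [← norm_mul, ← hlin]
    congr 1
    push_cast
    linear_combination (A i * p.1 + B i * p.2) * hst'
  have hdet : ∀ i j, ‖A i * x + B i * y‖ * ‖A j * x + B j * y‖ * ‖α i - α j‖ =
      ‖A i * B j - A j * B i‖ := fun i j => by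
    rw [← norm_mul, ← norm_mul]
    congr 1
    linear_combination (A j * x + B j * y) * hα i - (A i * x + B i * y) * hα j +
      (A i * B j - A j * B i) * hst'
  obtain ⟨a', b', c', d', e', hcomp⟩ := exists_quartic_comp a b c d e x s y t
  have ha' : (a' : ℂ) = quarticFormVal a b c d e p₀.1 := by
    have := hcomp 1 0
    simp only [mul_one, mul_zero, add_zero] at this
    rw [quarticFormVal]
    push_cast
    linear_combination -this
  have haprod : ∏ i, (A i * x + B i * y) = (a' : ℂ) := by
    rw [← h.eval, ha', quarticFormVal]
    push_cast
    rfl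
  have haa : (a' : ℂ) * a' = 1 := by
    rw [ha']
    rcases hval with hv | hv <;> rw [hv] <;> norm_num
  have hroots : QuarticRoots (a' * b') (a' * c') (a' * d') (a' * e') α := by
    have key : ∀ u v : ℂ, 1 * u ^ 4 + (a' * b') * u ^ 3 * v + (a' * c') * u ^ 2 * v ^ 2 +
        (a' * d') * u * v ^ 3 + (a' * e') * v ^ 4 =
        1 * u ^ 4 + (-(α 0 + α 1 + α 2 + α 3)) * u ^ 3 * v +
        (α 0 * α 1 + α 0 * α 2 + α 0 * α 3 + α 1 * α 2 + α 1 * α 3 + α 2 * α 3) * u ^ 2 * v ^ 2 +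
        (-(α 0 * α 1 * α 2 + α 0 * α 1 * α 3 + α 0 * α 2 * α 3 + α 1 * α 2 * α 3)) * u * v ^ 3 +
        (α 0 * α 1 * α 2 * α 3) * v ^ 4 := by
      intro u v
      have e1 := h.eval (x * u + s * v) (y * u + t * v)
      simp only [hlin, Finset.prod_mul_distrib, haprod] at e1
      rw [hcomp, Fin.prod_univ_four] at e1
      linear_combination a' * e1 + ((u - α 0 * v) * (u - α 1 * v) * (u - α 2 * v) * (u - α 3 * v)
        - u ^ 4) * haa
    obtain ⟨-, h1, h2, h3, h4⟩ := eq_of_forall_quartic_eq key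
    exact ⟨by push_cast; exact h1, by push_cast; exact h2, by push_cast; exact h3,
      by push_cast; exact h4⟩
  refine ⟨a' * b', a' * c', a' * d', a' * e', α, fun i => ‖A i * x + B i * y‖,
    fun p => (t * p.1 - s * p.2, x * p.2 - y * p.1), hroots, ⟨fun i j hij => ?_, hL, ?_,
      fun i j k hT => ?_⟩, hdet, ?_, fun p q => ?_, hform, fun p => ?_⟩
  · by_contra hne
    have := hdet i j
    rw [hij, sub_self, norm_zero, mul_zero] at this
    exact h.ne i j hne (norm_eq_zero.1 this.symm)
  · rw [Fin.prod_univ_four] at hprod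
    linarith
  · rw [hdet, hdet]
    refine h.eq 0 k i j ?_
    revert hT
    revert i j k
    decide
  · ext
    · linarith
    · ring
  · linear_combination (p.1 * q.2 - p.2 * q.1) * hst
  · have h1 := prod_linear_eq_one_of_sol h p
    simp only [← hform, Finset.prod_mul_distrib, hprod, one_mul] at h1
    exact h1

/-- If each of `27` solutions is pairwise inequivalent, seven of them lie in one class and can be
ordered by the size of the smallest linear form. -/
theorem exists_seven_in_class (N : Fin 27 → Fin 4 → ℝ) :
    ∃ (m : Fin 4) (f : Fin 7 → Fin 27), Function.Injective f ∧ (∀ k i, N (f k) m ≤ N (f k) i) ∧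
      Antitone fun k => N (f k) m := by
  choose κ hκ using fun k => Finite.exists_min (N k)
  obtain ⟨m, -, hm⟩ := Finset.exists_lt_card_fiber_of_mul_lt_card_of_maps_to
    (s := Finset.univ) (t := Finset.univ) (f := κ) (n := 6) (by simp) (by simp)
  obtain ⟨s, hs, hcard⟩ := Finset.exists_subset_card_eq (Nat.succ_le_of_lt hm)
  let g : Fin 7 → Fin 27 := fun k => s.orderEmbOfFin hcard k
  have hg : ∀ k, κ (g k) = m := fun k =>
    (Finset.mem_filter.1 (hs (s.orderEmbOfFin_mem hcard k))).2
  let σ := Tuple.sort fun k => -N (g k) m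
  have hσ := Tuple.monotone_sort fun k => -N (g k) m
  refine ⟨m, g ∘ σ, (s.orderEmbOfFin hcard).injective.comp σ.injective, fun k i => ?_,
    fun j k hjk => neg_le_neg_iff.1 (hσ hjk)⟩
  rw [← hg (σ k)]
  exact hκ _ i

theorem not_exists_pairwise_not_pmRel : ∃ N : ℕ, ∀ a b c d e : ℤ,
    (N : ℤ) ≤ |quarticDisc a b c d e| → ∀ s : Fin 27 → QuarticThueSol a b c d e,
    ¬ ∀ j k, j ≠ k → ¬ pmRelQuartic a b c d e (s j) (s k) := by
  obtain ⟨Δ₀, hΔ₀⟩ := not_exists_seven_points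
  refine ⟨⌈max Δ₀ 1 ^ 4⌉₊, fun a b c d e hN s hs => ?_⟩
  have hN' : max Δ₀ 1 ^ 4 ≤ |(quarticDisc a b c d e : ℝ)| :=
    (Nat.le_ceil _).trans (by exact_mod_cast hN)
  have hD : quarticDisc a b c d e ≠ 0 := fun h0 => by
    rw [h0, Int.cast_zero, abs_zero] at hN'
    have : 0 < max Δ₀ 1 ^ 4 := by positivity
    linarith
  obtain ⟨A, B, hAB⟩ := exists_isBalancedFactorization a b c d e hD
  obtain ⟨m, f, hf, hmin, hanti⟩ := exists_seven_in_class fun k i =>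
    ‖A i * (s k).1.1 + B i * (s k).1.2‖
  let σ : Equiv.Perm (Fin 4) := Equiv.swap 0 m
  have hσ : σ 0 = m := Equiv.swap_apply_left 0 m
  obtain ⟨b', c', d', e', α, w, φ, hroots, hbal, hdet, hφ₀, hφdet, hφ, hφprod⟩ :=
    (hAB.comp_perm σ).exists_chart (s (f 0))
  have hφ' : ∀ p i, formAbs α w (φ p) i = ‖A (σ i) * p.1 + B (σ i) * p.2‖ := hφ
  refine hΔ₀ hroots hbal ?_ (fun k => φ (s (f k)).1) hφ₀ (fun k => ⟨hφprod _, fun i => ?_⟩)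
    (fun j k hjk h0 => ?_) ?_
  · refine (le_max_left Δ₀ 1).trans (le_of_pow_le_pow_left₀ (n := 4) (by norm_num) ?_ ?_)
    · unfold frameAbs
      have := hbal.pos
      have := (this 0).le
      have := (hbal.pos 1).le
      have := (hbal.pos 2).le
      have := (hbal.pos 3).le
      positivity
    · simp only [frameAbs, hdet]
      rwa [(hAB.comp_perm σ).disc 0 1 2 3 (by decide)]
  · rw [hφ', hφ', hσ]
    exact hmin k _
  · rw [hφdet] at h0
    exact hs _ _ (hf.ne hjk) (QuarticThueSol.pmRel_of_det_eq_zero _ _ h0)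
  · simp only [hφ', hσ]
    exact hanti

/-- There is a constant `N` such that every quartic Thue equation `F(U,V) = ±1`, with
`F` irreducible over `ℚ` of discriminant of absolute value at least `N`, has at most
`26` integer solutions (counting `(u,v)` and `(-u,-v)` as one solution). -/
theorem quartic_thue_eq_large_disc_at_most_26_solutions :
    ∃ N : ℕ, ∀ a b c d e : ℤ,
      Irreducible
        (MvPolynomial.C (a : ℚ) * MvPolynomial.X 0 ^ 4 +
          MvPolynomial.C (b : ℚ) * MvPolynomial.X 0 ^ 3 * MvPolynomial.X 1 +
          MvPolynomial.C (c : ℚ) * MvPolynomial.X 0 ^ 2 * MvPolynomial.X 1 ^ 2 +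
          MvPolynomial.C (d : ℚ) * MvPolynomial.X 0 * MvPolynomial.X 1 ^ 3 +
          MvPolynomial.C (e : ℚ) * MvPolynomial.X 1 ^ 4 : MvPolynomial (Fin 2) ℚ) →
      (N : ℤ) ≤ |quarticDisc a b c d e| →
      Finite (Quot (pmRelQuartic a b c d e)) ∧
        Nat.card (Quot (pmRelQuartic a b c d e)) ≤ 26 := by
  obtain ⟨N, hN⟩ := not_exists_pairwise_not_pmRel
  refine ⟨N, fun a b c d e _ hD => ?_⟩
  by_contra hcon
  obtain ⟨g⟩ : Nonempty (Fin 27 ↪ Quot (pmRelQuartic a b c d e)) := by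
    rcases finite_or_infinite (Quot (pmRelQuartic a b c d e)) with hfin | hinf
    · have : Fintype (Quot (pmRelQuartic a b c d e)) := Fintype.ofFinite _
      refine Function.Embedding.nonempty_of_card_le ?_
      rw [Fintype.card_fin, ← Nat.card_eq_fintype_card]
      by_contra! hlt
      exact hcon ⟨hfin, by omega⟩
    · exact ⟨Fin.valEmbedding.trans (Infinite.natEmbedding _)⟩
  refine hN a b c d e hD (fun k => (g k).out) fun j k hjk hrel => hjk (g.injective ?_)
  rw [← Quot.out_eq (g j), ← Quot.out_eq (g k)]
  exact Quot.sound hrel
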